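/- Let Q and Q′ define germs at 0 of real-analytic hypersurfaces M and M′ in ℂ², both of finite type at 0 (i.e., Q(z,χ,0) ≢ 0 and Q′(z′,χ′,0) ≢ 0). If H¹ and H² are local biholomorphisms (ℂ²,0) → (ℂ²,0) each satisfying the mapping identity for (Q,Q′) (so each sends M into M′), and all partial derivatives of H¹ and H² of order ≤ 2 at 0 agree, then H¹ = H² on a neighborhood of 0. In other words, local biholomorphisms between hypersurfaces of finite type in ℂ² are uniquely determined by their 2-jets at a point. -/

import Mathlib

open Filter Topology Matrix

noncomputable section

/-- Complex conjugation as a plain function. -/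
def cj : ℂ → ℂ := (starRingEnd ℂ)

/-- Iterated partial derivative `∂_z^i ∂_w^j F (z, w)` of `F : ℂ → ℂ → ℂ`. -/
def pd (F : ℂ → ℂ → ℂ) (i j : ℕ) (z w : ℂ) : ℂ :=
  deriv^[i] (fun z' => deriv^[j] (F z') w) z

/-- `Q` is a normal-coordinates defining function (near `0`) of a germ of a
real-analytic hypersurface in `ℂ²`. -/
def IsNormalCoord (Q : ℂ → ℂ → ℂ → ℂ) : Prop :=
  AnalyticAt ℂ (fun p : ℂ × ℂ × ℂ => Q p.1 p.2.1 p.2.2) 0 ∧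
  (∀ᶠ p : ℂ × ℂ in 𝓝 0, Q p.1 0 p.2 = p.2) ∧
  (∀ᶠ p : ℂ × ℂ in 𝓝 0, Q 0 p.1 p.2 = p.2) ∧
  (∀ᶠ p : ℂ × ℂ × ℂ in 𝓝 0, Q p.1 p.2.1 (cj (Q (cj p.2.1) (cj p.1) (cj p.2.2))) = p.2.2)

/-- The mapping identity expressing that the germ at `0` of the holomorphic map
`H = (F, G)` (with `H(0) = 0`) sends the hypersurface defined by `Q` into the one
defined by `Q'`. -/
def SendsInto (Q Q' : ℂ → ℂ → ℂ → ℂ) (F G : ℂ → ℂ → ℂ) : Prop :=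
  AnalyticAt ℂ (fun p : ℂ × ℂ => F p.1 p.2) 0 ∧
  AnalyticAt ℂ (fun p : ℂ × ℂ => G p.1 p.2) 0 ∧
  F 0 0 = 0 ∧ G 0 0 = 0 ∧
  ∀ᶠ p : ℂ × ℂ × ℂ in 𝓝 0,
    G p.1 (Q p.1 p.2.1 p.2.2) =
      Q' (F p.1 (Q p.1 p.2.1 p.2.2)) (cj (F (cj p.2.1) (cj p.2.2))) (cj (G (cj p.2.1) (cj p.2.2)))

/-- Determinant of the Jacobian matrix of `H = (F, G)` at `0`. -/
def JacDet (F G : ℂ → ℂ → ℂ) : ℂ :=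
  pd F 1 0 0 0 * pd G 0 1 0 0 - pd F 0 1 0 0 * pd G 1 0 0 0

/-- The hypersurface defined by `Q` is not Levi-flat near `0`, i.e. `Q(z,χ,τ) ≢ τ`. -/
def NotLeviFlat (Q : ℂ → ℂ → ℂ → ℂ) : Prop :=
  ¬ ∀ᶠ p : ℂ × ℂ × ℂ in 𝓝 0, Q p.1 p.2.1 p.2.2 = p.2.2

/-- The hypersurface defined by `Q` is of finite type at `0`, i.e. `Q(z,χ,0) ≢ 0`. -/
def FiniteTypeAt (Q : ℂ → ℂ → ℂ → ℂ) : Prop :=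
  ¬ ∀ᶠ p : ℂ × ℂ in 𝓝 0, Q p.1 p.2 0 = 0

/-- `q_{αμ}(χ) = ∂_z^α ∂_τ^μ Q(0, χ, 0)`. -/
def qd (Q : ℂ → ℂ → ℂ → ℂ) (α μ : ℕ) (χ : ℂ) : ℂ :=
  deriv^[α] (fun z => deriv^[μ] (fun τ => Q z χ τ) 0) 0

/-- The hypersurface (germ) defined by `Q` as a subset of `ℂ²`. -/
def MSet (Q : ℂ → ℂ → ℂ → ℂ) : Set (ℂ × ℂ) := {p | p.2 = Q p.1 (cj p.1) (cj p.2)}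


section Division
variable {E V : Type*} [NormedAddCommGroup E] [NormedSpace ℂ E]
  [NormedAddCommGroup V] [NormedSpace ℂ V]

theorem AnalyticAt.fderiv_apply_const [CompleteSpace V] {f : E → V} {x : E} (hf : AnalyticAt ℂ f x) (v : E) :
    AnalyticAt ℂ (fun y => fderiv ℂ f y v) x :=
  ((ContinuousLinearMap.apply ℂ V v).analyticAt _).comp hf.fderiv

/-- Averaging an analytic function over a compact continuous family of linear contractions of its
variable gives an analytic function. -/
theorem AnalyticAt.intervalIntegral_comp_clm {f : E → V} (hf : AnalyticAt ℂ f 0)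
    {L : ℝ → E →L[ℂ] E} (hL : Continuous L) (hL1 : ∀ t ∈ Set.Ioc (0 : ℝ) 1, ‖L t‖ ≤ 1) :
    AnalyticAt ℂ (fun x => ∫ t in (0 : ℝ)..1, f (L t x)) 0 := by
  obtain ⟨p, R, hp⟩ := hf
  obtain ⟨r, hr0, hrR⟩ := ENNReal.lt_iff_exists_nnreal_btwn.1 hp.r_pos
  have hrp : (r : ENNReal) < p.radius := hrR.trans_le hp.r_le
  have hcont : ∀ n, Continuous fun t => (p n).compContinuousLinearMap (fun _ => L t) := by
    intro n
    have h1 : Continuous fun t =>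
        ContinuousMultilinearMap.compContinuousLinearMapContinuousMultilinear ℂ
          (fun _ : Fin n => E) (fun _ : Fin n => E) V (fun _ => L t) :=
      (ContinuousMultilinearMap.cont _).comp (continuous_pi fun _ => hL)
    exact h1.clm_apply continuous_const
  have hnorm : ∀ n, ∀ t ∈ Set.Ioc (0 : ℝ) 1,
      ‖(p n).compContinuousLinearMap (fun _ => L t)‖ ≤ ‖p n‖ := by
    intro n t ht
    refine (ContinuousMultilinearMap.norm_compContinuousLinearMap_le _ _).trans ?_
    refine mul_le_of_le_one_right (norm_nonneg _) ?_
    exact Finset.prod_le_one (fun _ _ => norm_nonneg _) (fun _ _ => hL1 t ht)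
  let q : FormalMultilinearSeries ℂ E V := fun n =>
    ∫ t in (0 : ℝ)..1, (p n).compContinuousLinearMap (fun _ => L t)
  have hq : ∀ n, ‖q n‖ ≤ ‖p n‖ := by
    intro n
    have := intervalIntegral.norm_integral_le_of_norm_le_const (a := 0) (b := 1)
      (f := fun t => (p n).compContinuousLinearMap (fun _ => L t)) (C := ‖p n‖)
      (by rw [Set.uIoc_of_le zero_le_one]; exact hnorm n)
    simpa using this
  have hsum := p.summable_norm_mul_pow hrp
  refine ⟨q, r, ⟨q.le_radius_of_summable ?_, by exact_mod_cast hr0, ?_⟩⟩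
  · exact hsum.of_nonneg_of_le (fun n => by positivity)
      fun n => mul_le_mul_of_nonneg_right (hq n) (by positivity)
  · intro y hy
    have hyr : ‖y‖ ≤ r := by
      have : y ∈ Metric.ball (0 : E) r := by simpa [Metric.eball_coe] using hy
      exact (mem_ball_zero_iff.1 this).le
    have key := intervalIntegral.hasSum_integral_of_dominated_convergence (a := 0) (b := 1)
      (μ := MeasureTheory.volume)
      (F := fun n t => (p n).compContinuousLinearMap (fun _ => L t) (fun _ => y))
      (f := fun t => f (L t (0 + y))) (fun n _ => ‖p n‖ * (r : ℝ) ^ n)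
      (fun n => ?_) (fun n => ?_) (by simp [hsum]) (by simp) ?_
    · convert key using 1
      ext n
      simp only [q, intervalIntegral.integral_of_le zero_le_one]
      exact ContinuousMultilinearMap.integral_apply
        (((hcont n).continuousOn.integrableOn_Icc).mono_set Set.Ioc_subset_Icc_self) _
    · refine Continuous.aestronglyMeasurable ?_
      exact ((ContinuousMultilinearMap.apply ℂ (fun _ : Fin n => E) V (fun _ => y)).continuous.comp
        (hcont n))
    · refine Eventually.of_forall fun t ht => ?_
      rw [Set.uIoc_of_le zero_le_one] at ht
      refine (ContinuousMultilinearMap.le_opNorm _ _).trans ?_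
      simp only [Finset.prod_const, Finset.card_univ, Fintype.card_fin]
      exact mul_le_mul (hnorm n t ht) (pow_le_pow_left₀ (norm_nonneg _) hyr _) (by positivity)
        (norm_nonneg _)
    · refine Eventually.of_forall fun t ht => ?_
      rw [Set.uIoc_of_le zero_le_one] at ht
      have hmem : L t y ∈ Metric.eball (0 : E) R := by
        rw [mem_eball_zero_iff] at hy ⊢
        refine lt_of_le_of_lt ?_ (hy.trans hrR)
        have : ‖L t y‖ ≤ ‖y‖ :=
          ((L t).le_opNorm y).trans (mul_le_of_le_one_left (norm_nonneg _) (hL1 t ht))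
        simpa [enorm_eq_nnnorm, ← NNReal.coe_le_coe] using this
      simpa using hp.hasSum hmem

/-- Hadamard's lemma for analytic functions. -/
theorem AnalyticAt.exists_eq_add_snd_smul [CompleteSpace V] {f : E × ℂ → V} (hf : AnalyticAt ℂ f 0) :
    ∃ g : E × ℂ → V, AnalyticAt ℂ g 0 ∧ ∀ᶠ p in 𝓝 (0 : E × ℂ), f p = f (p.1, 0) + p.2 • g p := by
  let L : ℝ → (E × ℂ) →L[ℂ] (E × ℂ) := fun t =>
    (ContinuousLinearMap.fst ℂ E ℂ).prod ((t : ℂ) • ContinuousLinearMap.snd ℂ E ℂ)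
  have hLc : Continuous L := by
    have : L = fun t : ℝ => (ContinuousLinearMap.inl ℂ E ℂ).comp (ContinuousLinearMap.fst ℂ E ℂ) +
        (t : ℂ) • (ContinuousLinearMap.inr ℂ E ℂ).comp (ContinuousLinearMap.snd ℂ E ℂ) := by
      funext t
      ext <;> simp [L]
    rw [this]
    fun_prop
  have hLn : ∀ t ∈ Set.Icc (0 : ℝ) 1, ∀ p, ‖L t p‖ ≤ ‖p‖ := by
    intro t ht p
    simp only [L, ContinuousLinearMap.prod_apply, ContinuousLinearMap.coe_fst',
      _root_.smul_apply, ContinuousLinearMap.coe_snd', Prod.norm_def]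
    refine max_le_max le_rfl ?_
    rw [norm_smul, Complex.norm_real, Real.norm_of_nonneg ht.1]
    exact mul_le_of_le_one_left (norm_nonneg _) ht.2
  refine ⟨fun p => ∫ t in (0 : ℝ)..1, fderiv ℂ f (L t p) (0, 1), ?_, ?_⟩
  · refine AnalyticAt.intervalIntegral_comp_clm (f := fun p => fderiv ℂ f p (0, 1)) ?_ hLc ?_
    · exact hf.fderiv_apply_const _
    · intro t ht
      exact ContinuousLinearMap.opNorm_le_bound _ zero_le_one fun p => by
        simpa using hLn t (Set.Ioc_subset_Icc_self ht) p
  · obtain ⟨ε, hε, hball⟩ := Metric.eventually_nhds_iff_ball.1 hf.eventually_analyticAt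
    filter_upwards [Metric.ball_mem_nhds _ hε] with p hp
    have hmem : ∀ t ∈ Set.Icc (0 : ℝ) 1, L t p ∈ Metric.ball (0 : E × ℂ) ε := fun t ht => by
      rw [mem_ball_zero_iff] at hp ⊢
      exact (hLn t ht p).trans_lt hp
    have hLp : ∀ t, L t p = (p.1, (t : ℂ) * p.2) := fun t => by simp [L]
    have hd : ∀ t ∈ Set.uIcc (0 : ℝ) 1, HasDerivAt (fun t => f (L t p))
        (p.2 • fderiv ℂ f (L t p) (0, 1)) t := by
      intro t ht
      rw [Set.uIcc_of_le zero_le_one] at ht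
      have h1 : HasDerivAt (fun t => L t p) ((0 : E), p.2) t := by
        simp only [hLp]
        refine (hasDerivAt_const t p.1).prodMk ?_
        simpa using (Complex.ofRealCLM.hasDerivAt (x := t)).mul_const p.2
      have h2 := ((hball _ (hmem t ht)).differentiableAt.hasFDerivAt.restrictScalars ℝ).comp_hasDerivAt
        t h1
      refine h2.congr_deriv ?_
      have : ((0 : E), p.2) = p.2 • ((0 : E), (1 : ℂ)) := by simp
      rw [ContinuousLinearMap.coe_restrictScalars', this, map_smul]
    have hcont : ContinuousOn (fun t : ℝ => p.2 • fderiv ℂ f (L t p) (0, 1)) (Set.uIcc 0 1) := by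
      rw [Set.uIcc_of_le zero_le_one]
      intro t ht
      have h1 : ContinuousAt (fun q => p.2 • fderiv ℂ f q (0, 1)) (L t p) :=
        ((hball _ (hmem t ht)).fderiv_apply_const _).continuousAt.const_smul _
      have h2 : ContinuousAt (fun t => L t p) t := (hLc.clm_apply continuous_const).continuousAt
      exact (ContinuousAt.comp (f := fun t => L t p) h1 h2).continuousWithinAt
    have hint := intervalIntegral.integral_eq_sub_of_hasDerivAt hd hcont.intervalIntegrable
    rw [intervalIntegral.integral_smul] at hint
    rw [hint, hLp, hLp]
    simp
end Division

section Division
variable {E V : Type*} [NormedAddCommGroup E] [NormedSpace ℂ E]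
  [NormedAddCommGroup V] [NormedSpace ℂ V]

/-- An analytic function divisible by all powers of the last variable vanishes. -/
theorem AnalyticAt.eventually_eq_zero_of_forall_snd_pow [CompleteSpace V] {f : E × ℂ → V} (hf : AnalyticAt ℂ f 0)
    (h : ∀ n : ℕ, ∃ g : E × ℂ → V, AnalyticAt ℂ g 0 ∧ ∀ᶠ p in 𝓝 0, f p = p.2 ^ n • g p) :
    ∀ᶠ p in 𝓝 0, f p = 0 := by
  obtain ⟨ε, hε, hball⟩ := Metric.eventually_nhds_iff_ball.1 hf.eventually_analyticAt
  filter_upwards [Metric.ball_mem_nhds _ hε] with p hp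
  have hline : ∀ t : ℂ, AnalyticAt ℂ (fun t : ℂ => t • p) t := fun t => by fun_prop
  set U : Set ℂ := (fun t : ℂ => t • p) ⁻¹' Metric.ball 0 ε with hU
  have hUc : IsPreconnected U := by
    have : Convex ℝ U := by
      have := (convex_ball (0 : E × ℂ) ε).linear_preimage
        ((LinearMap.toSpanSingleton ℂ (E × ℂ) p).restrictScalars ℝ)
      exact this
    exact this.isPreconnected
  have hφ : AnalyticOnNhd ℂ (fun t : ℂ => f (t • p)) U := fun t ht =>
    AnalyticAt.comp (f := fun t : ℂ => t • p) (hball _ ht) (hline t)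
  have h0 : (0 : ℂ) ∈ U := by simp [hU, hε]
  have h1 : (1 : ℂ) ∈ U := by simpa [hU] using hp
  have htend : Tendsto (fun t : ℂ => t • p) (𝓝 0) (𝓝 0) := by
    have := (hline 0).continuousAt.tendsto
    rwa [zero_smul] at this
  have hord : analyticOrderAt (fun t : ℂ => f (t • p)) 0 = ⊤ := by
    refine ENat.eq_top_iff_forall_ge.2 fun n => ?_
    obtain ⟨g, hg, hfg⟩ := h n
    rw [natCast_le_analyticOrderAt (hφ 0 h0)]
    refine ⟨fun t => p.2 ^ n • g (t • p), ?_, ?_⟩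
    · refine AnalyticAt.fun_const_smul (AnalyticAt.comp (f := fun t : ℂ => t • p) ?_ (hline 0))
      simpa using hg
    · filter_upwards [htend.eventually hfg] with t ht
      simp [ht, mul_pow, mul_smul]
  have := hφ.eqOn_zero_of_preconnected_of_eventuallyEq_zero hUc h0 (analyticOrderAt_eq_top.1 hord) h1
  simpa using this

/-- A nonzero germ factors as a power of the last variable times a germ not divisible by it. -/
theorem AnalyticAt.exists_eq_snd_pow_smul [CompleteSpace V] {f : E × ℂ → V} (hf : AnalyticAt ℂ f 0)
    (hf0 : ¬ ∀ᶠ p in 𝓝 0, f p = 0) :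
    ∃ (n : ℕ) (g : E × ℂ → V), AnalyticAt ℂ g 0 ∧ (∀ᶠ p in 𝓝 0, f p = p.2 ^ n • g p) ∧
      ¬ ∀ᶠ x in 𝓝 0, g (x, 0) = 0 := by
  by_contra! hcon
  refine hf0 (hf.eventually_eq_zero_of_forall_snd_pow fun n => ?_)
  induction n with
  | zero => exact ⟨f, hf, by simp⟩
  | succ n ih =>
    obtain ⟨g, hg, hfg⟩ := ih
    obtain ⟨g', hg', hgg'⟩ := hg.exists_eq_add_snd_smul
    refine ⟨g', hg', ?_⟩
    have h0 : ∀ᶠ p : E × ℂ in 𝓝 0, g (p.1, 0) = 0 :=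
      (continuous_fst.tendsto' (0 : E × ℂ) 0 rfl).eventually (hcon n g hg hfg)
    filter_upwards [hfg, hgg', h0] with p h1 h2 h3
    rw [h1, h2, h3, zero_add, smul_smul, pow_succ]

end Division

theorem AnalyticAt.eventually_ne_zero_and_deriv_ne_zero {f : ℂ → ℂ} (hf : AnalyticAt ℂ f 0)
    (h0 : f 0 = 0) (hne : ¬ ∀ᶠ z in 𝓝 0, f z = 0) :
    ∀ᶠ z in 𝓝[≠] 0, f z ≠ 0 ∧ deriv f z ≠ 0 := by
  refine (hf.eventually_eq_zero_or_eventually_ne_zero.resolve_left hne).and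
    (hf.deriv.eventually_eq_zero_or_eventually_ne_zero.resolve_left fun hd => hne ?_)
  have h1 := hf.analyticOrderAt_deriv_add_one
  rw [analyticOrderAt_eq_top.2 hd] at h1
  simpa [h0] using analyticOrderAt_eq_top.1 h1.symm

/-- A map tangent to the identity preserving a nonconstant analytic function is the identity. -/
theorem eventually_eq_id_of_comp_eq {p ψ : ℂ → ℂ} (hp : AnalyticAt ℂ p 0) (hp0 : p 0 = 0)
    (hne : ¬ ∀ᶠ x in 𝓝 0, p x = 0) (hψ : (fun x => ψ x - x) =o[𝓝 0] fun x => x)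
    (h : ∀ᶠ x in 𝓝 0, p (ψ x) = p x) : ∀ᶠ x in 𝓝 0, ψ x = x := by
  obtain ⟨m, u, hu, hu0, hpu⟩ := hp.exists_eventuallyEq_pow_smul_nonzero_iff.2 hne
  simp only [sub_zero, smul_eq_mul] at hpu
  have hm : (m : ℂ) ≠ 0 := by
    rintro hm
    rw [Nat.cast_eq_zero] at hm
    have := hpu.self_of_nhds
    exact hu0 (by simpa [hp0, hm] using this.symm)
  have hψ0 : Tendsto ψ (𝓝 0) (𝓝 0) := by
    have h1 : Tendsto (fun x => ψ x - x) (𝓝 0) (𝓝 0) := hψ.trans_tendsto tendsto_id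
    simpa using h1.add tendsto_id
  have he : Tendsto (fun x => ψ x / x) (𝓝[≠] 0) (𝓝 1) := by
    have h1 := (hψ.tendsto_div_nhds_zero.mono_left (nhdsWithin_le_nhds (s := {0}ᶜ))).add_const 1
    rw [zero_add] at h1
    refine h1.congr' ?_
    filter_upwards [self_mem_nhdsWithin] with x hx
    have hx : x ≠ 0 := hx
    field_simp
    ring
  obtain ⟨K, s, hs, hK⟩ := hu.hasStrictDerivAt.hasStrictFDerivAt.exists_lipschitzOnWith
  have hsum : Tendsto (fun x => ‖∑ i ∈ Finset.range m, (ψ x / x) ^ i‖ * ‖u (ψ x)‖ - K * ‖x‖)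
      (𝓝[≠] 0) (𝓝 (‖(m : ℂ)‖ * ‖u 0‖)) := by
    have h1 : Tendsto (fun x => ∑ i ∈ Finset.range m, (ψ x / x) ^ i) (𝓝[≠] 0) (𝓝 (m : ℂ)) := by
      have := tendsto_finsetSum (Finset.range m) fun i _ => he.pow i
      simpa using this
    have h2 : Tendsto (fun x => u (ψ x)) (𝓝[≠] 0) (𝓝 (u 0)) :=
      hu.continuousAt.tendsto.comp (hψ0.mono_left nhdsWithin_le_nhds)
    have h3 : Tendsto (fun x : ℂ => K * ‖x‖) (𝓝[≠] 0) (𝓝 0) := by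
      refine Tendsto.mono_left ?_ nhdsWithin_le_nhds
      exact Continuous.tendsto' (by fun_prop) _ _ (by simp)
    simpa using (h1.norm.mul h2.norm).sub h3
  have hpos : (0 : ℝ) < ‖(m : ℂ)‖ * ‖u 0‖ := by positivity
  have hmain : ∀ᶠ x in 𝓝[≠] 0, ψ x = x := by
    filter_upwards [hsum.eventually (lt_mem_nhds hpos), self_mem_nhdsWithin,
      nhdsWithin_le_nhds h, nhdsWithin_le_nhds hpu, nhdsWithin_le_nhds (hψ0.eventually hpu),
      nhdsWithin_le_nhds hs, nhdsWithin_le_nhds (hψ0.eventually hs)] with x h1 hx h2 h3 h4 h5 h6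
    have hx : x ≠ 0 := hx
    set e := ψ x / x with he
    have hψx : ψ x = e * x := by rw [he]; field_simp
    rw [h2, h3, hψx, mul_pow, ← hψx] at h4
    have h7 : (∑ i ∈ Finset.range m, e ^ i) * (e - 1) * u (ψ x) = u x - u (ψ x) := by
      rw [geom_sum_mul]
      have := pow_ne_zero m hx
      apply mul_left_cancel₀ this
      linear_combination -h4
    have h8 := hK.dist_le_mul x h5 (ψ x) h6
    rw [dist_eq_norm, dist_eq_norm, ← h7, hψx] at h8
    have h9 : x - e * x = -(x * (e - 1)) := by ring
    rw [h9, norm_neg, norm_mul, norm_mul, norm_mul, ← hψx] at h8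
    have h10 : ‖e - 1‖ * (‖∑ i ∈ Finset.range m, e ^ i‖ * ‖u (ψ x)‖ - K * ‖x‖) ≤ 0 := by
      linarith
    have h11 : ‖e - 1‖ ≤ 0 := by
      by_contra! hlt
      exact absurd h10 (not_le.2 (mul_pos hlt h1))
    have : e = 1 := sub_eq_zero.1 (norm_le_zero_iff.1 h11)
    rw [hψx, this, one_mul]
  have h0 : ψ 0 = 0 := by
    have := hψ.isBigO.eq_zero_imp.self_of_nhds rfl
    simpa using this
  rw [eventually_nhdsWithin_iff] at hmain
  filter_upwards [hmain] with x hx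
  rcases eq_or_ne x 0 with rfl | hx0
  · exact h0
  · exact hx hx0

/-- Basic limits attached to `r x = x ^ s * ρ (z, x)` as `x → 0`. -/
theorem tendsto_pow_mul_punctured {ρ : ℂ × ℂ → ℂ} {z : ℂ} {s : ℕ} (hs : s ≠ 0)
    (hρ : AnalyticAt ℂ ρ (z, 0)) (hρ0 : ρ (z, 0) ≠ 0) :
    Tendsto (fun x => ρ (z, x)) (𝓝[≠] 0) (𝓝 (ρ (z, 0))) ∧
      Tendsto (fun x => x ^ s * ρ (z, x)) (𝓝[≠] 0) (𝓝[≠] 0) := by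
  have h1 : Tendsto (fun x => ρ (z, x)) (𝓝[≠] 0) (𝓝 (ρ (z, 0))) :=
    (hρ.continuousAt.tendsto.comp
      ((by fun_prop : Continuous fun x : ℂ => (z, x)).tendsto' 0 (z, 0) rfl)).mono_left
      nhdsWithin_le_nhds
  refine ⟨h1, tendsto_nhdsWithin_iff.2 ⟨?_, ?_⟩⟩
  · have h2 : Tendsto (fun x : ℂ => x ^ s) (𝓝[≠] 0) (𝓝 0) :=
      ((continuous_pow s).tendsto' 0 0 (by simp [hs])).mono_left nhdsWithin_le_nhds
    simpa using h2.mul h1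
  · filter_upwards [h1.eventually_ne hρ0, self_mem_nhdsWithin] with x hx hx0
    exact mul_ne_zero (pow_ne_zero _ hx0) hx

/-- The difference quotient of `f` in its first variable converges along `z + h x`. -/
theorem AnalyticAt.tendsto_slope_fst {f : ℂ × ℂ → ℂ} {z : ℂ} (hf : AnalyticAt ℂ f (z, 0))
    {h : ℂ → ℂ} (hh : Tendsto h (𝓝[≠] 0) (𝓝 0)) :
    ∃ c : ℂ → ℂ, Tendsto c (𝓝[≠] 0) (𝓝 (fderiv ℂ f (z, 0) (1, 0))) ∧
      ∀ᶠ x in 𝓝[≠] 0, f (z + h x, x) - f (z, x) = h x * c x := by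
  have hid : Tendsto (fun x : ℂ => x) (𝓝[≠] 0) (𝓝 0) := tendsto_id.mono_left nhdsWithin_le_nhds
  have ht : Tendsto (fun x => ((z + h x, x), (z, x))) (𝓝[≠] 0) (𝓝 (((z, 0), (z, 0)) : (ℂ × ℂ) × ℂ × ℂ)) := by
    have h1 : Tendsto (fun x => z + h x) (𝓝[≠] 0) (𝓝 z) := by
      simpa using hh.const_add z
    exact (h1.prodMk_nhds hid).prodMk_nhds (tendsto_const_nhds.prodMk_nhds hid)
  have ho := (hf.hasStrictFDerivAt.isLittleO.comp_tendsto ht)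
  set c0 := fderiv ℂ f (z, 0) (1, 0) with hc0
  have ho' : (fun x => f (z + h x, x) - f (z, x) - h x * c0) =o[𝓝[≠] 0] h := by
    refine (ho.congr (fun x => ?_) (fun x => rfl)).trans_isBigO ?_
    · have : (h x, (0 : ℂ)) = h x • ((1 : ℂ), (0 : ℂ)) := by simp
      simp only [Function.comp, Prod.mk_sub_mk, add_sub_cancel_left, sub_self]
      rw [this, map_smul, smul_eq_mul]
    · refine Asymptotics.IsBigO.of_bound 1 (Eventually.of_forall fun x => ?_)
      simp [Prod.norm_def]
  refine ⟨fun x => if h x = 0 then c0 else (f (z + h x, x) - f (z, x)) / h x, ?_, ?_⟩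
  · have h2 := ho'.tendsto_div_nhds_zero.add_const c0
    rw [zero_add] at h2
    refine h2.congr fun x => ?_
    split_ifs with hx
    · simp [hx]
    · field_simp
      ring
  · refine Eventually.of_forall fun x => ?_
    simp only
    split_ifs with hx
    · simp [hx]
    · field_simp

theorem pushforward_first_relation {ρ : ℂ × ℂ → ℂ} {a b : ℂ → ℂ} {z : ℂ} {s k : ℕ}
    (hs : s ≠ 0) (hk : k ≠ 0) (hρ : AnalyticAt ℂ ρ (z, 0)) (hρ0 : ρ (z, 0) ≠ 0)
    (ha : ContinuousAt a 0) (hb : DifferentiableAt ℂ b 0)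
    (h : ∀ᶠ x in 𝓝 0, (x ^ s * ρ (z, x)) ^ k * b (x ^ s * ρ (z, x)) =
      x ^ s * (ρ (z + (x ^ s * ρ (z, x)) ^ k * a (x ^ s * ρ (z, x)), x) - ρ (z, x))) :
    b 0 = 0 ∧ ρ (z, 0) * deriv b 0 = fderiv ℂ ρ (z, 0) (1, 0) * a 0 := by
  obtain ⟨h1, h2⟩ := tendsto_pow_mul_punctured hs hρ hρ0
  set r : ℂ → ℂ := fun x => x ^ s * ρ (z, x) with hr
  have hr0 : Tendsto r (𝓝[≠] 0) (𝓝 0) := h2.mono_right nhdsWithin_le_nhds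
  have har : Tendsto (fun x => a (r x)) (𝓝[≠] 0) (𝓝 (a 0)) := ha.tendsto.comp hr0
  have hbr : Tendsto (fun x => b (r x)) (𝓝[≠] 0) (𝓝 (b 0)) := hb.continuousAt.tendsto.comp hr0
  have hh : Tendsto (fun x => r x ^ k * a (r x)) (𝓝[≠] 0) (𝓝 0) := by
    simpa [hk] using (hr0.pow k).mul har
  obtain ⟨c, hc, hceq⟩ := hρ.tendsto_slope_fst hh
  have hrne : ∀ᶠ x in 𝓝[≠] 0, r x ≠ 0 := h2.eventually self_mem_nhdsWithin
  have key : ∀ᶠ x in 𝓝[≠] 0, b (r x) = x ^ s * (a (r x) * c x) := by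
    filter_upwards [nhdsWithin_le_nhds h, hceq, hrne] with x h1 h2 h3
    rw [h2] at h1
    apply mul_left_cancel₀ (pow_ne_zero k h3)
    rw [h1]; ring
  have hxs : Tendsto (fun x : ℂ => x ^ s) (𝓝[≠] 0) (𝓝 0) :=
    ((continuous_pow s).tendsto' 0 0 (by simp [hs])).mono_left nhdsWithin_le_nhds
  have hb0 : b 0 = 0 := by
    have h3 := hxs.mul (har.mul hc)
    rw [zero_mul] at h3
    exact tendsto_nhds_unique hbr (h3.congr' (key.mono fun x hx => hx.symm))
  refine ⟨hb0, ?_⟩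
  have hslope : Tendsto (fun x => b (r x) / r x) (𝓝[≠] 0) (𝓝 (deriv b 0)) := by
    have := (hasDerivAt_iff_tendsto_slope.1 hb.hasDerivAt).comp h2
    refine this.congr fun x => ?_
    simp [slope_def_field, hb0]
  have h4 := h1.mul hslope
  have h5 := har.mul hc
  rw [mul_comm (a 0)] at h5
  refine tendsto_nhds_unique h4 (h5.congr' ?_)
  filter_upwards [key, self_mem_nhdsWithin, hrne] with x h6 h7 h8
  rw [h6]
  have h7 : x ≠ 0 := h7
  have h9 : r x = x ^ s * ρ (z, x) := rfl
  have h10 : ρ (z, x) ≠ 0 := fun h => h8 (by rw [h9, h, mul_zero])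
  rw [h9]
  field_simp

theorem pushforward_second_relation {ρ v : ℂ × ℂ → ℂ} {a b X : ℂ → ℂ} {z : ℂ} {s k : ℕ}
    (hs : s ≠ 0) (hk : k ≠ 0) (hρ : AnalyticAt ℂ ρ (z, 0)) (hρ0 : ρ (z, 0) ≠ 0)
    (ha : AnalyticAt ℂ a 0) (hb : AnalyticAt ℂ b 0) (hb0 : b 0 = 0)
    (hv : AnalyticAt ℂ v (z, 0)) (hv1 : ∀ᶠ y in 𝓝 z, v (y, 0) = 1)
    (hX : X =o[𝓝[≠] 0] fun x => x ^ s * (x ^ s * ρ (z, x)) ^ (k - 1))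
    (h : ∀ᶠ x in 𝓝 0, ∀ r y, r = x ^ s * ρ (z, x) → y = z + r ^ k * a r →
      (k * r ^ (k - 1) * b r + r ^ k * deriv b r) * v (z, x) =
        x ^ s * fderiv ℂ ρ (y, x) (1, 0) * ((k * r ^ (k - 1) * a r + r ^ k * deriv a r) * v (z, x)) +
          X x + (v (y, x) - v (z, x))) :
    (k + 1) * (ρ (z, 0) * deriv b 0) = k * (fderiv ℂ ρ (z, 0) (1, 0) * a 0) := by
  obtain ⟨h1, h2⟩ := tendsto_pow_mul_punctured hs hρ hρ0
  set r : ℂ → ℂ := fun x => x ^ s * ρ (z, x) with hr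
  have hr0 : Tendsto r (𝓝[≠] 0) (𝓝 0) := h2.mono_right nhdsWithin_le_nhds
  have hid : Tendsto (fun x : ℂ => x) (𝓝[≠] 0) (𝓝 0) := tendsto_id.mono_left nhdsWithin_le_nhds
  have har : Tendsto (fun x => a (r x)) (𝓝[≠] 0) (𝓝 (a 0)) := ha.continuousAt.tendsto.comp hr0
  have har' : Tendsto (fun x => deriv a (r x)) (𝓝[≠] 0) (𝓝 (deriv a 0)) :=
    ha.deriv.continuousAt.tendsto.comp hr0
  have hbr' : Tendsto (fun x => deriv b (r x)) (𝓝[≠] 0) (𝓝 (deriv b 0)) :=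
    hb.deriv.continuousAt.tendsto.comp hr0
  have hslope : Tendsto (fun x => b (r x) / r x) (𝓝[≠] 0) (𝓝 (deriv b 0)) := by
    have := (hasDerivAt_iff_tendsto_slope.1 hb.differentiableAt.hasDerivAt).comp h2
    refine this.congr fun x => ?_
    simp [slope_def_field, hb0]
  have hh : Tendsto (fun x => r x ^ k * a (r x)) (𝓝[≠] 0) (𝓝 0) := by
    simpa [hk] using (hr0.pow k).mul har
  obtain ⟨c, hc, hceq⟩ := hv.tendsto_slope_fst hh
  have hc0 : fderiv ℂ v (z, 0) (1, 0) = 0 := by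
    have h3 : HasDerivAt (fun y => v (y, 0)) (fderiv ℂ v (z, 0) (1, 0)) z :=
      hv.differentiableAt.hasFDerivAt.comp_hasDerivAt z
        ((hasDerivAt_id z).prodMk (hasDerivAt_const z (0 : ℂ)))
    have h4 : HasDerivAt (fun y => v (y, 0)) 0 z :=
      (hasDerivAt_const z (1 : ℂ)).congr_of_eventuallyEq hv1
    exact h3.unique h4
  rw [hc0] at hc
  have hvx : Tendsto (fun x => v (z, x)) (𝓝[≠] 0) (𝓝 1) := by
    rw [← hv1.self_of_nhds]
    exact hv.continuousAt.tendsto.comp (tendsto_const_nhds.prodMk_nhds hid)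
  have hρ' : Tendsto (fun x => fderiv ℂ ρ (z + r x ^ k * a (r x), x) (1, 0)) (𝓝[≠] 0)
      (𝓝 (fderiv ℂ ρ (z, 0) (1, 0))) := by
    refine (hρ.fderiv_apply_const (1, 0)).continuousAt.tendsto.comp ?_
    have h3 : Tendsto (fun x => z + r x ^ k * a (r x)) (𝓝[≠] 0) (𝓝 z) := by
      simpa using hh.const_add z
    exact h3.prodMk_nhds hid
  have hrne : ∀ᶠ x in 𝓝[≠] 0, r x ≠ 0 := h2.eventually self_mem_nhdsWithin
  have hXt : Tendsto (fun x => X x / (x ^ s * r x ^ (k - 1))) (𝓝[≠] 0) (𝓝 0) :=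
    hX.tendsto_div_nhds_zero
  have hL : Tendsto (fun x => (k * (b (r x) / r x) * ρ (z, x) + ρ (z, x) * deriv b (r x)) * v (z, x))
      (𝓝[≠] 0) (𝓝 ((k * deriv b 0 * ρ (z, 0) + ρ (z, 0) * deriv b 0) * 1)) :=
    (((hslope.const_mul _).mul h1).add (h1.mul hbr')).mul hvx
  have hR : Tendsto (fun x => fderiv ℂ ρ (z + r x ^ k * a (r x), x) (1, 0) *
      ((k * a (r x) + r x * deriv a (r x)) * v (z, x)) + X x / (x ^ s * r x ^ (k - 1)) +
        ρ (z, x) * a (r x) * c x) (𝓝[≠] 0)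
      (𝓝 (fderiv ℂ ρ (z, 0) (1, 0) * ((k * a 0 + 0 * deriv a 0) * 1) + 0 + ρ (z, 0) * a 0 * 0)) :=
    ((hρ'.mul (((har.const_mul _).add (hr0.mul har')).mul hvx)).add hXt).add ((h1.mul har).mul hc)
  have heq := tendsto_nhds_unique hL (hR.congr' ?_)
  · linear_combination heq
  · filter_upwards [nhdsWithin_le_nhds h, hceq, hrne, self_mem_nhdsWithin] with x h3 h4 h5 h6
    have h6 : x ≠ 0 := h6
    have h3 := h3 (r x) _ rfl rfl
    rw [h4] at h3
    obtain ⟨j, rfl⟩ := Nat.exists_eq_succ_of_ne_zero hk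
    simp only [Nat.succ_eq_add_one, Nat.add_sub_cancel] at h3 ⊢
    have h9 : r x = x ^ s * ρ (z, x) := rfl
    have h10 : ρ (z, x) ≠ 0 := fun h => h5 (by rw [h9, h, mul_zero])
    have h11 : x ^ s * r x ^ j ≠ 0 := mul_ne_zero (pow_ne_zero _ h6) (pow_ne_zero _ h5)
    apply mul_left_cancel₀ h11
    have h12 : x ^ s * r x ^ j * (X x / (x ^ s * r x ^ j)) = X x := by field_simp
    have h13 : x ^ s * ρ (z, x) * (b (r x) / r x) = b (r x) := by
      rw [← h9]; field_simp
    rw [mul_add, mul_add, h12]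
    linear_combination -h3 - (r x ^ j * a (r x) * c x) * h9 -
      ((j + 1 : ℕ) * r x ^ j * v (z, x)) * h13 + (r x ^ j * deriv b (r x) * v (z, x)) * h9

@[simp] theorem cj_zero : cj 0 = 0 := map_zero _
@[simp] theorem cj_one : cj 1 = 1 := map_one _
@[simp] theorem cj_cj (z : ℂ) : cj (cj z) = z := Complex.conj_conj z
@[simp] theorem norm_cj (z : ℂ) : ‖cj z‖ = ‖z‖ := Complex.norm_conj z
theorem continuous_cj : Continuous cj := Complex.continuous_conj
theorem tendsto_cj_zero : Tendsto cj (𝓝 0) (𝓝 0) := continuous_cj.tendsto' 0 0 cj_zero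

theorem HasDerivAt.cj_comp_cj {f : ℂ → ℂ} {f' : ℂ} (hf : HasDerivAt f f' 0) :
    HasDerivAt (fun x => cj (f (cj x))) (cj f') 0 := by
  have := HasDerivAt.conj_conj (f := f) (x := 0) (f' := f') (by simpa using hf)
  rw [map_zero] at this
  exact this

/-- A map of the form `z + O(3), w + O(3)` preserving a finite type hypersurface fixes the
complex line `w = 0` pointwise. -/
theorem eq_id_on_zero_segre {Q : ℂ × ℂ × ℂ → ℂ} {F G : ℂ × ℂ → ℂ} (hQ : AnalyticAt ℂ Q 0)
    (hQ1 : ∀ᶠ p : ℂ × ℂ in 𝓝 0, Q (p.1, 0, p.2) = p.2)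
    (hQ2 : ∀ᶠ p : ℂ × ℂ in 𝓝 0, Q (0, p.1, p.2) = p.2)
    (hFT : ¬ ∀ᶠ p : ℂ × ℂ in 𝓝 0, Q (p.1, p.2, 0) = 0)
    (hF : AnalyticAt ℂ F 0) (hG : AnalyticAt ℂ G 0)
    (hFO : (fun p : ℂ × ℂ => F p - p.1) =O[𝓝 0] fun p => ‖p‖ ^ 3)
    (hGO : (fun p : ℂ × ℂ => G p - p.2) =O[𝓝 0] fun p => ‖p‖ ^ 3)
    (hmap : ∀ᶠ q : ℂ × ℂ × ℂ in 𝓝 0, G (q.1, Q q) =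
      Q (F (q.1, Q q), cj (F (cj q.2.1, cj q.2.2)), cj (G (cj q.2.1, cj q.2.2)))) :
    ∀ᶠ z in 𝓝 (0 : ℂ), F (z, 0) = z ∧ G (z, 0) = 0 := by
  have hF0 : F 0 = 0 := by simpa using hFO.eq_zero_imp.self_of_nhds (by simp)
  have hG0 : G 0 = 0 := by simpa using hGO.eq_zero_imp.self_of_nhds (by simp)
  have hF0' : F (0, 0) = 0 := hF0
  have hG0' : G (0, 0) = 0 := hG0
  have hFt : Tendsto F (𝓝 0) (𝓝 0) := by simpa [hF0] using hF.continuousAt.tendsto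
  have hGt : Tendsto G (𝓝 0) (𝓝 0) := by simpa [hG0] using hG.continuousAt.tendsto
  have hz0 : Tendsto (fun z : ℂ => ((z, 0) : ℂ × ℂ)) (𝓝 0) (𝓝 0) :=
    Continuous.tendsto' (by fun_prop) _ _ rfl
  have h0z : Tendsto (fun z : ℂ => ((0, z) : ℂ × ℂ)) (𝓝 0) (𝓝 0) :=
    Continuous.tendsto' (by fun_prop) _ _ rfl
  have hGz : ∀ᶠ z in 𝓝 (0 : ℂ), G (z, 0) = 0 := by
    have hz00 : Tendsto (fun z : ℂ => ((z, 0, 0) : ℂ × ℂ × ℂ)) (𝓝 0) (𝓝 0) :=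
      Continuous.tendsto' (by fun_prop) _ _ rfl
    have hz1 : Tendsto (fun z : ℂ => ((F (z, 0), 0) : ℂ × ℂ)) (𝓝 0) (𝓝 0) :=
      hz0.comp (hFt.comp hz0)
    filter_upwards [hz00.eventually hmap, hz0.eventually hQ1, hz1.eventually hQ1] with z h1 h2 h3
    simpa [h2, hF0', hG0', h3] using h1
  -- the function `f (χ, z) = Q (z, χ, 0)`
  set f : ℂ × ℂ → ℂ := fun p => Q (p.2, p.1, 0) with hf
  have hfa : AnalyticAt ℂ f 0 := by
    refine AnalyticAt.comp (f := fun p : ℂ × ℂ => (p.2, p.1, (0 : ℂ))) ?_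
      (analyticAt_snd.prod (analyticAt_fst.prod analyticAt_const))
    exact hQ
  have hf0 : Tendsto f (𝓝 0) (𝓝 0) := by
    have h1 : f 0 = 0 := hQ1.self_of_nhds
    simpa [h1] using hfa.continuousAt.tendsto
  have hswap : Tendsto (Prod.swap : ℂ × ℂ → ℂ × ℂ) (𝓝 0) (𝓝 0) :=
    continuous_swap.tendsto' _ _ rfl
  obtain ⟨α, q, hq, hfq, hq0⟩ := hfa.exists_eq_snd_pow_smul fun h => hFT (hswap.eventually h)
  obtain ⟨B, hB, hGB⟩ := hG.exists_eq_add_snd_smul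
  have hα : α ≠ 0 := by
    rintro rfl
    refine hq0 ?_
    filter_upwards [hz0.eventually hfq, hz0.eventually hQ2] with x h1 h2
    simpa [hf, h2] using h1.symm
  have hq00 : q (0, 0) = 0 := by
    have h1 : Tendsto (fun z => q (0, z)) (𝓝[≠] 0) (𝓝 (q 0)) :=
      (hq.continuousAt.tendsto.comp h0z).mono_left nhdsWithin_le_nhds
    refine tendsto_nhds_unique h1 (tendsto_const_nhds.congr' ?_)
    filter_upwards [nhdsWithin_le_nhds (h0z.eventually hfq), self_mem_nhdsWithin,
      nhdsWithin_le_nhds (hz0.eventually hQ1)] with z h2 h3 h4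
    have h5 : z ^ α ≠ 0 := pow_ne_zero _ h3
    have h6 : z ^ α * q (0, z) = 0 := by simpa [hf, h4] using h2.symm
    exact ((mul_eq_zero.1 h6).resolve_left h5).symm
  have hB1 : B 0 = 1 := by
    have h1 : Tendsto (fun w => B (0, w)) (𝓝[≠] 0) (𝓝 (B 0)) :=
      (hB.continuousAt.tendsto.comp h0z).mono_left nhdsWithin_le_nhds
    have h2 : (fun w : ℂ => G (0, w) - w) =o[𝓝 0] fun w => w := by
      have h3 := hGO.comp_tendsto h0z
      refine h3.trans_isLittleO ?_
      have h4 : (fun w : ℂ => w ^ 3) =o[𝓝 0] fun w : ℂ => w ^ 1 :=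
        Asymptotics.isLittleO_pow_pow (by norm_num)
      have h5 := h4.norm_left
      simpa [Function.comp_def, Prod.norm_def] using h5
    have h3 := (h2.tendsto_div_nhds_zero.mono_left (nhdsWithin_le_nhds (s := {0}ᶜ))).add_const 1
    rw [zero_add] at h3
    refine tendsto_nhds_unique h1 (h3.congr' ?_)
    filter_upwards [nhdsWithin_le_nhds (h0z.eventually hGB), self_mem_nhdsWithin] with w h4 h5
    have h5 : w ≠ 0 := h5
    simp only [hG0', zero_add, smul_eq_mul] at h4
    rw [h4]
    field_simp
    ring
  set ψ : ℂ → ℂ := fun x => cj (F (cj x, 0)) with hψ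
  have hψ0 : Tendsto ψ (𝓝 0) (𝓝 0) :=
    tendsto_cj_zero.comp (hFt.comp (hz0.comp tendsto_cj_zero))
  have hψo : (fun x => ψ x - x) =o[𝓝 0] fun x => x := by
    have h3 := hFO.comp_tendsto (hz0.comp tendsto_cj_zero)
    have h4 : (fun w : ℂ => w ^ 3) =o[𝓝 0] fun w : ℂ => w ^ 1 :=
      Asymptotics.isLittleO_pow_pow (by norm_num)
    have h5 : (fun x => ψ x - x) =O[𝓝 0] fun w : ℂ => w ^ 3 := by
      rw [← Asymptotics.isBigO_norm_norm] at h3 ⊢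
      refine h3.congr (fun x => ?_) fun x => ?_
      · rw [← norm_cj]
        simp [hψ, cj]
      · simp [Prod.norm_def]
    simpa using h5.trans_isLittleO h4
  have hid : ∀ᶠ x in 𝓝 0, ψ x = x := by
    refine eventually_eq_id_of_comp_eq (p := fun x => q (x, 0)) ?_ hq00 hq0 hψo ?_
    · exact AnalyticAt.comp (f := fun x : ℂ => (x, (0 : ℂ))) hq (by fun_prop)
    have hzf : Tendsto (fun p : ℂ × ℂ => (p.2, f p)) (𝓝 0) (𝓝 0) :=
      (continuous_snd.tendsto' (0 : ℂ × ℂ) 0 rfl).prodMk_nhds hf0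
    have hψF : Tendsto (fun p : ℂ × ℂ => (ψ p.1, F (p.2, f p))) (𝓝 0) (𝓝 0) :=
      (hψ0.comp (continuous_fst.tendsto' (0 : ℂ × ℂ) 0 rfl)).prodMk_nhds (hFt.comp hzf)
    have hQt : Tendsto (fun p : ℂ × ℂ => ((p.2, p.1, 0) : ℂ × ℂ × ℂ)) (𝓝 0) (𝓝 0) :=
      Continuous.tendsto' (by fun_prop) _ _ rfl
    have key : ∀ᶠ p : ℂ × ℂ in 𝓝 0, p.2 ^ α * q p * B (p.2, f p) =
        F (p.2, f p) ^ α * q (ψ p.1, F (p.2, f p)) := by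
      filter_upwards [hQt.eventually hmap, hfq, hψF.eventually hfq, hzf.eventually hGB,
        (continuous_snd.tendsto' (0 : ℂ × ℂ) 0 rfl).eventually hGz,
        (tendsto_cj_zero.comp (continuous_fst.tendsto' (0 : ℂ × ℂ) 0 rfl)).eventually hGz]
        with p h1 h2 h3 h4 h5 h6
      simp only [Function.comp] at h6
      simp only [cj_zero, h6] at h1
      change G (p.2, f p) = f (ψ p.1, F (p.2, f p)) at h1
      simp only [h5, zero_add, smul_eq_mul] at h4 h2 h3
      rw [← h2, ← h3, ← h1, h4]
    have hcurry : ∀ {P : ℂ × ℂ → Prop}, (∀ᶠ p in 𝓝 (0 : ℂ × ℂ), P p) →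
        ∀ᶠ x in 𝓝 (0 : ℂ), ∀ᶠ z in 𝓝 (0 : ℂ), P (x, z) := fun h =>
      Filter.Eventually.curry_nhds (x := (0 : ℂ)) (y := (0 : ℂ)) h
    filter_upwards [hcurry key, hcurry hfq, hz0.eventually hfa.eventually_analyticAt,
      hz0.eventually hq.eventually_analyticAt,
      (hz0.comp hψ0).eventually hq.eventually_analyticAt, hz0.eventually hfq]
      with x h1 h2 h3 h4 h5 h6
    have hxz : Tendsto (fun z : ℂ => (x, z)) (𝓝 0) (𝓝 (x, 0)) :=
      Continuous.tendsto' (by fun_prop) _ _ rfl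
    have hfx : Tendsto (fun z => f (x, z)) (𝓝 0) (𝓝 0) := by
      have h7 : f (x, 0) = 0 := by simpa [hα] using h6
      have h8 : Tendsto (fun z => f (x, z)) (𝓝 0) (𝓝 (f (x, 0))) :=
        h3.continuousAt.tendsto.comp hxz
      rwa [h7] at h8
    have hqx : Tendsto (fun z => q (x, z)) (𝓝 0) (𝓝 (q (x, 0))) :=
      h4.continuousAt.tendsto.comp hxz
    have hzr : Tendsto (fun z => (z, f (x, z))) (𝓝 0) (𝓝 (0 : ℂ × ℂ)) :=
      tendsto_id.prodMk_nhds hfx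
    have hBx : Tendsto (fun z => B (z, f (x, z))) (𝓝 0) (𝓝 1) := by
      rw [← hB1]; exact hB.continuousAt.tendsto.comp hzr
    have hFx : Tendsto (fun z => F (z, f (x, z))) (𝓝 0) (𝓝 0) := hFt.comp hzr
    have hqψ : Tendsto (fun z => q (ψ x, F (z, f (x, z)))) (𝓝 0) (𝓝 (q (ψ x, 0))) :=
      h5.continuousAt.tendsto.comp (tendsto_const_nhds.prodMk_nhds hFx)
    have hfO : (fun z => f (x, z)) =O[𝓝 0] fun z : ℂ => z := by
      have h7 : (fun z => z ^ α * q (x, z)) =O[𝓝 0] fun z : ℂ => z ^ 1 * 1 := by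
        refine Asymptotics.IsBigO.mul ?_ (hqx.isBigO_one ℂ)
        refine Asymptotics.IsBigO.of_bound 1 ?_
        filter_upwards [(continuous_norm.tendsto' (0 : ℂ) 0 (by simp)).eventually_le_const one_pos]
          with z hz
        rw [norm_pow, norm_pow, one_mul]
        exact pow_le_pow_of_le_one (norm_nonneg z) hz (Nat.one_le_iff_ne_zero.2 hα)
      simp only [pow_one, mul_one] at h7
      exact h7.congr' (h2.mono fun z hz => hz.symm) EventuallyEq.rfl
    have hFo : (fun z => F (z, f (x, z)) - z) =o[𝓝 0] fun z : ℂ => z := by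
      have h7 := hFO.comp_tendsto hzr
      have h8 : (fun z => (z, f (x, z))) =O[𝓝 0] fun z : ℂ => z :=
        (Asymptotics.isBigO_refl _ _).prod_left hfO
      have h9 : (fun w : ℂ => w ^ 3) =o[𝓝 0] fun w : ℂ => w ^ 1 :=
        Asymptotics.isLittleO_pow_pow (by norm_num)
      simp only [pow_one] at h9
      refine h7.trans_isLittleO (Asymptotics.IsBigO.trans_isLittleO ?_ h9)
      have h10 := (h8.norm_left.pow 3)
      simpa [Function.comp_def] using h10
    have hFq : Tendsto (fun z => F (z, f (x, z)) / z) (𝓝[≠] 0) (𝓝 1) := by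
      have h7 := (hFo.tendsto_div_nhds_zero.mono_left (nhdsWithin_le_nhds (s := {0}ᶜ))).add_const 1
      rw [zero_add] at h7
      refine h7.congr' ?_
      filter_upwards [self_mem_nhdsWithin] with z hz
      have hz : z ≠ 0 := hz
      field_simp
      ring
    have hl := (hqx.mul hBx).mono_left (nhdsWithin_le_nhds (s := {0}ᶜ))
    have hr := (hFq.pow α).mul (hqψ.mono_left (nhdsWithin_le_nhds (s := {0}ᶜ)))
    rw [mul_one] at hl
    rw [one_pow, one_mul] at hr
    refine tendsto_nhds_unique hr (hl.congr' ?_)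
    filter_upwards [nhdsWithin_le_nhds h1, self_mem_nhdsWithin] with z h7 h8
    have h8 : z ≠ 0 := h8
    rw [div_pow]
    field_simp
    linear_combination h7
  filter_upwards [hGz, tendsto_cj_zero.eventually hid] with z h1 h2
  refine ⟨?_, h1⟩
  simpa [hψ] using congrArg cj h2

theorem AnalyticAt.hasDerivAt_snd {f : ℂ × ℂ → ℂ} {p : ℂ × ℂ} (hf : AnalyticAt ℂ f p) :
    HasDerivAt (fun w => f (p.1, w)) (fderiv ℂ f p (0, 1)) p.2 :=
  hf.differentiableAt.hasFDerivAt.comp_hasDerivAt (f := fun w => (p.1, w)) p.2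
    ((hasDerivAt_const p.2 p.1).prodMk (hasDerivAt_id p.2))

theorem AnalyticAt.hasDerivAt_fst {f : ℂ × ℂ → ℂ} {p : ℂ × ℂ} (hf : AnalyticAt ℂ f p) :
    HasDerivAt (fun z => f (z, p.2)) (fderiv ℂ f p (1, 0)) p.1 :=
  hf.differentiableAt.hasFDerivAt.comp_hasDerivAt (f := fun z => (z, p.2)) p.1
    ((hasDerivAt_id p.1).prodMk (hasDerivAt_const p.1 p.2))

/-- The `w`-derivative of `c w + w ^ k A (z, w)`. -/
theorem fderiv_snd_eq_of_eventually_eq_pow_mul {Φ A : ℂ × ℂ → ℂ} {g : ℂ × ℂ → ℂ} {c : ℂ} {k : ℕ}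
    (hΦ : AnalyticAt ℂ Φ 0) (hA : AnalyticAt ℂ A 0)
    (hg : ∀ p : ℂ × ℂ, HasDerivAt (fun w => g (p.1, w)) c p.2)
    (h : ∀ᶠ p in 𝓝 0, Φ p - g p = p.2 ^ k * A p) :
    ∀ᶠ p in 𝓝 (0 : ℂ × ℂ), fderiv ℂ Φ p (0, 1) =
      c + (k * p.2 ^ (k - 1) * A p + p.2 ^ k * deriv (fun w => A (p.1, w)) p.2) := by
  filter_upwards [hΦ.eventually_analyticAt, hA.eventually_analyticAt, h.eventually_nhds]
    with p h1 h2 h3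
  have h4 : Tendsto (fun w => (p.1, w)) (𝓝 p.2) (𝓝 p) :=
    Continuous.tendsto' (by fun_prop) _ _ rfl
  have h5 := h1.hasDerivAt_snd
  have h6 := (hg p).add ((hasDerivAt_pow k p.2).mul h2.hasDerivAt_snd)
  rw [h2.hasDerivAt_snd.deriv]
  refine h5.unique (h6.congr_of_eventuallyEq ?_)
  filter_upwards [h4.eventually h3] with w h7
  simp only [Pi.add_apply, Pi.mul_apply]
  linear_combination h7

/-- The mapping identity differentiated in `τ` along `τ = 0`. -/
theorem mapping_identity_deriv {Q : ℂ × ℂ × ℂ → ℂ} {F G : ℂ × ℂ → ℂ} (hQ : AnalyticAt ℂ Q 0)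
    (hQ0 : Q 0 = 0) (hF : AnalyticAt ℂ F 0) (hG : AnalyticAt ℂ G 0)
    (hz : ∀ᶠ z in 𝓝 (0 : ℂ), F (z, 0) = z ∧ G (z, 0) = 0)
    (hmap : ∀ᶠ q : ℂ × ℂ × ℂ in 𝓝 0, G (q.1, Q q) =
      Q (F (q.1, Q q), cj (F (cj q.2.1, cj q.2.2)), cj (G (cj q.2.1, cj q.2.2)))) :
    ∀ᶠ p : ℂ × ℂ in 𝓝 0, ∀ r y, r = Q (p.1, p.2, 0) → y = F (p.1, r) →
      fderiv ℂ G (p.1, r) (0, 1) * fderiv ℂ Q (p.1, p.2, 0) (0, 0, 1) =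
        fderiv ℂ Q (y, p.2, 0) (1, 0, 0) *
          (fderiv ℂ F (p.1, r) (0, 1) * fderiv ℂ Q (p.1, p.2, 0) (0, 0, 1)) +
        fderiv ℂ Q (y, p.2, 0) (0, 1, 0) * cj (fderiv ℂ F (cj p.2, 0) (0, 1)) +
        fderiv ℂ Q (y, p.2, 0) (0, 0, 1) * cj (fderiv ℂ G (cj p.2, 0) (0, 1)) := by
  have hF0 : F 0 = 0 := hz.self_of_nhds.1
  have t0 : Tendsto (fun p : ℂ × ℂ => ((p.1, p.2, 0) : ℂ × ℂ × ℂ)) (𝓝 0) (𝓝 0) :=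
    Continuous.tendsto' (by fun_prop) _ _ rfl
  have tQ : Tendsto (fun p : ℂ × ℂ => Q (p.1, p.2, 0)) (𝓝 0) (𝓝 0) := by
    simpa [hQ0, Function.comp_def] using hQ.continuousAt.tendsto.comp t0
  have t1 : Tendsto (fun p : ℂ × ℂ => (p.1, Q (p.1, p.2, 0))) (𝓝 0) (𝓝 0) :=
    (continuous_fst.tendsto' (0 : ℂ × ℂ) 0 rfl).prodMk_nhds tQ
  have t2 : Tendsto (fun p : ℂ × ℂ => F (p.1, Q (p.1, p.2, 0))) (𝓝 0) (𝓝 0) := by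
    simpa [hF0, Function.comp_def] using hF.continuousAt.tendsto.comp t1
  have t3 : Tendsto (fun p : ℂ × ℂ => (F (p.1, Q (p.1, p.2, 0)), p.2, (0 : ℂ))) (𝓝 0) (𝓝 0) :=
    t2.prodMk_nhds ((continuous_snd.tendsto' (0 : ℂ × ℂ) 0 rfl).prodMk_nhds tendsto_const_nhds)
  have t4 : Tendsto (fun p : ℂ × ℂ => cj p.2) (𝓝 0) (𝓝 0) :=
    tendsto_cj_zero.comp (continuous_snd.tendsto' (0 : ℂ × ℂ) 0 rfl)
  have t5 : Tendsto (fun p : ℂ × ℂ => (cj p.2, (0 : ℂ))) (𝓝 0) (𝓝 0) :=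
    t4.prodMk_nhds tendsto_const_nhds
  filter_upwards [t0.eventually hQ.eventually_analyticAt, t3.eventually hQ.eventually_analyticAt,
    t1.eventually hF.eventually_analyticAt, t1.eventually hG.eventually_analyticAt,
    t5.eventually hF.eventually_analyticAt, t5.eventually hG.eventually_analyticAt,
    t4.eventually hz, t0.eventually hmap.eventually_nhds]
  rintro ⟨z, χ⟩ q1 q2 f1 g1 f2 g2 ⟨e1, e2⟩ hm r y hr hy
  simp only at q1 q2 f1 g1 f2 g2 hm e1 e2 hr hy ⊢
  rw [← hr] at q2 f1 g1
  rw [← hy] at q2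
  have d1 : HasDerivAt (fun τ => Q (z, χ, τ)) (fderiv ℂ Q (z, χ, 0) (0, 0, 1)) 0 :=
    q1.differentiableAt.hasFDerivAt.comp_hasDerivAt (f := fun τ => (z, χ, τ)) 0
      ((hasDerivAt_const _ _).prodMk ((hasDerivAt_const _ _).prodMk (hasDerivAt_id _)))
  have d2 : HasDerivAt (fun τ => (z, Q (z, χ, τ))) ((0 : ℂ), fderiv ℂ Q (z, χ, 0) (0, 0, 1)) 0 :=
    (hasDerivAt_const _ _).prodMk d1
  have lin : ∀ (L : ℂ × ℂ →L[ℂ] ℂ) (c : ℂ), L (0, c) = L (0, 1) * c := fun L c => by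
    have : ((0 : ℂ), c) = c • ((0 : ℂ), (1 : ℂ)) := by simp
    rw [this, map_smul, smul_eq_mul, mul_comm]
  have lin3 : ∀ (L : ℂ × ℂ × ℂ →L[ℂ] ℂ) (a b c : ℂ), L (a, b, c) =
      L (1, 0, 0) * a + L (0, 1, 0) * b + L (0, 0, 1) * c := fun L a b c => by
    have : ((a, b, c) : ℂ × ℂ × ℂ) = a • ((1 : ℂ), (0 : ℂ), (0 : ℂ)) +
      b • ((0 : ℂ), (1 : ℂ), (0 : ℂ)) + c • ((0 : ℂ), (0 : ℂ), (1 : ℂ)) := by simp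
    rw [this]
    simp only [map_add, map_smul, smul_eq_mul]
    ring
  have dG : HasDerivAt (fun τ => G (z, Q (z, χ, τ)))
      (fderiv ℂ G (z, r) (0, 1) * fderiv ℂ Q (z, χ, 0) (0, 0, 1)) 0 := by
    have d3 : HasFDerivAt G (fderiv ℂ G (z, r)) (z, Q (z, χ, 0)) := by
      rw [← hr]; exact g1.differentiableAt.hasFDerivAt
    rw [← lin]
    exact d3.comp_hasDerivAt (f := fun τ => (z, Q (z, χ, τ))) (0 : ℂ) d2
  have dF : HasDerivAt (fun τ => F (z, Q (z, χ, τ)))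
      (fderiv ℂ F (z, r) (0, 1) * fderiv ℂ Q (z, χ, 0) (0, 0, 1)) 0 := by
    have d3 : HasFDerivAt F (fderiv ℂ F (z, r)) (z, Q (z, χ, 0)) := by
      rw [← hr]; exact f1.differentiableAt.hasFDerivAt
    rw [← lin]
    exact d3.comp_hasDerivAt (f := fun τ => (z, Q (z, χ, τ))) (0 : ℂ) d2
  have dFc : HasDerivAt (fun τ => cj (F (cj χ, cj τ))) (cj (fderiv ℂ F (cj χ, 0) (0, 1))) 0 :=
    HasDerivAt.cj_comp_cj (f := fun w => F (cj χ, w)) f2.hasDerivAt_snd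
  have dGc : HasDerivAt (fun τ => cj (G (cj χ, cj τ))) (cj (fderiv ℂ G (cj χ, 0) (0, 1))) 0 :=
    HasDerivAt.cj_comp_cj (f := fun w => G (cj χ, w)) g2.hasDerivAt_snd
  have hpt : (F (z, Q (z, χ, 0)), cj (F (cj χ, cj 0)), cj (G (cj χ, cj 0))) = (y, χ, 0) := by
    rw [← hr, ← hy, cj_zero, e1, e2, cj_cj, cj_zero]
  have d4 : HasFDerivAt Q (fderiv ℂ Q (y, χ, 0))
      (F (z, Q (z, χ, 0)), cj (F (cj χ, cj 0)), cj (G (cj χ, cj 0))) := by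
    rw [hpt]; exact q2.differentiableAt.hasFDerivAt
  have dR := d4.comp_hasDerivAt
    (f := fun τ => (F (z, Q (z, χ, τ)), cj (F (cj χ, cj τ)), cj (G (cj χ, cj τ)))) (0 : ℂ)
    (dF.prodMk (dFc.prodMk dGc))
  rw [lin3] at dR
  refine dG.unique (dR.congr_of_eventuallyEq ?_)
  have h4 : Tendsto (fun w : ℂ => (z, χ, w)) (𝓝 0) (𝓝 (z, χ, 0)) :=
    Continuous.tendsto' (by fun_prop) _ _ rfl
  filter_upwards [h4.eventually hm] with τ h5
  exact h5

/-- If `w A (z, w) = O(3)` then `A (z, 0) = o(z)`. -/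
theorem isLittleO_of_snd_mul_isBigO {A : ℂ × ℂ → ℂ} (hA : AnalyticAt ℂ A 0)
    (h : (fun p : ℂ × ℂ => p.2 * A p) =O[𝓝 0] fun p => ‖p‖ ^ 3) :
    (fun x => A (x, 0)) =o[𝓝 0] fun x : ℂ => x := by
  have h1 : ∀ c : ℂ, HasDerivAt (fun t => A (c * t, t)) (fderiv ℂ A 0 (c, 1)) 0 := fun c => by
    have h2 : HasDerivAt (fun t : ℂ => (c * t, t)) (c, 1) 0 := by
      simpa using ((hasDerivAt_id (0 : ℂ)).const_mul c).prodMk (hasDerivAt_id (0 : ℂ))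
    have h3 : HasFDerivAt A (fderiv ℂ A 0) (c * 0, 0) := by
      rw [mul_zero]; exact hA.differentiableAt.hasFDerivAt
    exact h3.comp_hasDerivAt (f := fun t : ℂ => (c * t, t)) (0 : ℂ) h2
  have h2 : ∀ c : ℂ, (fun t => A (c * t, t)) =o[𝓝[≠] 0] fun t : ℂ => t := fun c => by
    have h3 : Tendsto (fun t : ℂ => (c * t, t)) (𝓝 0) (𝓝 0) :=
      Continuous.tendsto' (by fun_prop) _ _ (by simp)
    have h4 := h.comp_tendsto h3
    have h5 : (fun t : ℂ => ‖((c * t, t) : ℂ × ℂ)‖ ^ 3) =O[𝓝 0] fun t : ℂ => t ^ 3 := by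
      refine Asymptotics.IsBigO.pow ?_ 3
      refine Asymptotics.IsBigO.norm_left ?_
      exact ((Asymptotics.isBigO_refl (fun t : ℂ => t) _).const_mul_left c).prod_left
        (Asymptotics.isBigO_refl _ _)
    have h6 : (fun t : ℂ => t * A (c * t, t)) =o[𝓝 0] fun t : ℂ => t ^ 2 :=
      (h4.trans h5).trans_isLittleO (Asymptotics.isLittleO_pow_pow (by norm_num))
    have h7 := (Asymptotics.isBigO_refl (fun t : ℂ => t⁻¹) (𝓝[≠] 0)).mul_isLittleO
      (h6.mono nhdsWithin_le_nhds)
    refine h7.congr' ?_ ?_ <;> filter_upwards [self_mem_nhdsWithin] with t ht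
    · have ht : t ≠ 0 := ht
      field_simp
    · have ht : t ≠ 0 := ht
      field_simp
  have h0 : A 0 = 0 := by
    have h3 : Tendsto (fun t : ℂ => A (0 * t, t)) (𝓝[≠] 0) (𝓝 0) :=
      (h2 0).trans_tendsto (tendsto_id.mono_left nhdsWithin_le_nhds)
    have h4 : Tendsto (fun t : ℂ => A (0 * t, t)) (𝓝[≠] 0) (𝓝 (A 0)) := by
      have := (h1 0).continuousAt.tendsto.mono_left (nhdsWithin_le_nhds (s := {0}ᶜ))
      simpa [show ((0 : ℂ), (0 : ℂ)) = 0 from rfl] using this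
    exact tendsto_nhds_unique h4 h3
  have h0' : A (0, 0) = 0 := h0
  have hL : ∀ c : ℂ, fderiv ℂ A 0 (c, 1) = 0 := fun c => by
    have h3 := hasDerivAt_iff_tendsto_slope.1 (h1 c)
    refine tendsto_nhds_unique h3 ((h2 c).tendsto_div_nhds_zero.congr fun t => ?_)
    simp [slope_def_field, h0']
  have hL0 : fderiv ℂ A 0 (1, 0) = 0 := by
    have : ((1 : ℂ), (0 : ℂ)) = (1, 1) - (0, 1) := by simp
    rw [this, map_sub, hL, hL, sub_zero]
  have h3 : HasDerivAt (fun z => A (z, 0)) (fderiv ℂ A 0 (1, 0)) 0 := hA.hasDerivAt_fst (p := 0)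
  rw [hL0, hasDerivAt_iff_isLittleO] at h3
  simpa [h0'] using h3

/-- A holomorphic self-map of a finite type hypersurface which agrees with the identity up to
order two is the identity. -/
theorem eq_id_of_isBigO_three {Q : ℂ × ℂ × ℂ → ℂ} {F G : ℂ × ℂ → ℂ} (hQ : AnalyticAt ℂ Q 0)
    (hQ1 : ∀ᶠ p : ℂ × ℂ in 𝓝 0, Q (p.1, 0, p.2) = p.2)
    (hQ2 : ∀ᶠ p : ℂ × ℂ in 𝓝 0, Q (0, p.1, p.2) = p.2)
    (hFT : ¬ ∀ᶠ p : ℂ × ℂ in 𝓝 0, Q (p.1, p.2, 0) = 0)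
    (hF : AnalyticAt ℂ F 0) (hG : AnalyticAt ℂ G 0)
    (hFO : (fun p : ℂ × ℂ => F p - p.1) =O[𝓝 0] fun p => ‖p‖ ^ 3)
    (hGO : (fun p : ℂ × ℂ => G p - p.2) =O[𝓝 0] fun p => ‖p‖ ^ 3)
    (hmap : ∀ᶠ q : ℂ × ℂ × ℂ in 𝓝 0, G (q.1, Q q) =
      Q (F (q.1, Q q), cj (F (cj q.2.1, cj q.2.2)), cj (G (cj q.2.1, cj q.2.2)))) :
    ∀ᶠ p in 𝓝 (0 : ℂ × ℂ), F p = p.1 ∧ G p = p.2 := by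
  have hz := eq_id_on_zero_segre hQ hQ1 hQ2 hFT hF hG hFO hGO hmap
  have hQ0 : Q 0 = 0 := hQ1.self_of_nhds
  have hz0 : Tendsto (fun z : ℂ => ((z, 0) : ℂ × ℂ)) (𝓝 0) (𝓝 0) :=
    Continuous.tendsto' (by fun_prop) _ _ rfl
  by_contra hcon
  obtain ⟨k, D, hD, hDeq, hD0⟩ := AnalyticAt.exists_eq_snd_pow_smul
    (f := fun p : ℂ × ℂ => (F p - p.1, G p - p.2))
    ((hF.sub analyticAt_fst).prod (hG.sub analyticAt_snd)) (by
      refine fun h => hcon (h.mono fun p hp => ?_)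
      simpa [Prod.ext_iff, sub_eq_zero] using hp)
  set A : ℂ × ℂ → ℂ := fun p => (D p).1 with hAdef
  set B : ℂ × ℂ → ℂ := fun p => (D p).2 with hBdef
  have hA : AnalyticAt ℂ A 0 := analyticAt_fst.comp hD
  have hB : AnalyticAt ℂ B 0 := analyticAt_snd.comp hD
  have hFA : ∀ᶠ p in 𝓝 0, F p - p.1 = p.2 ^ k * A p := hDeq.mono fun p hp => by
    simpa using congrArg Prod.fst hp
  have hGB : ∀ᶠ p in 𝓝 0, G p - p.2 = p.2 ^ k * B p := hDeq.mono fun p hp => by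
    simpa using congrArg Prod.snd hp
  have hk : k ≠ 0 := by
    rintro rfl
    refine hD0 ?_
    filter_upwards [hz, hz0.eventually hDeq] with z h1 h2
    simpa [h1, Prod.ext_iff] using h2.symm
  -- vanishing off the origin suffices
  have ext0 : ∀ f : ℂ × ℂ → ℂ, AnalyticAt ℂ f 0 → (∀ᶠ z in 𝓝[≠] (0 : ℂ), f (z, 0) = 0) →
      ∀ᶠ z in 𝓝 (0 : ℂ), f (z, 0) = 0 := by
    intro f hf h
    have h1 : ContinuousAt (fun z => f (z, 0)) 0 :=
      ContinuousAt.comp (f := fun z : ℂ => (z, (0 : ℂ))) hf.continuousAt hz0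
    have h2 : f (0, 0) = 0 := by
      refine tendsto_nhds_unique (h1.tendsto.mono_left (nhdsWithin_le_nhds (s := {0}ᶜ)))
        (tendsto_const_nhds.congr' (h.mono fun z hz => hz.symm))
    rw [eventually_nhdsWithin_iff] at h
    filter_upwards [h] with z hz
    by_cases h3 : z = 0
    · rw [h3, h2]
    · exact hz h3
  -- the function `r (z, χ) = Q (z, χ, 0) = χ ^ s ρ (z, χ)`
  have hra : AnalyticAt ℂ (fun p : ℂ × ℂ => Q (p.1, p.2, 0)) 0 :=
    AnalyticAt.comp (g := Q) (f := fun p : ℂ × ℂ => (p.1, p.2, (0 : ℂ))) hQ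
      (analyticAt_fst.prod (analyticAt_snd.prod analyticAt_const))
  obtain ⟨s, ρ, hρ, hrρ, hρ0⟩ := hra.exists_eq_snd_pow_smul hFT
  simp only [smul_eq_mul] at hrρ
  have hs : s ≠ 0 := by
    rintro rfl
    refine hρ0 ?_
    filter_upwards [hz0.eventually hrρ, hz0.eventually hQ1] with z h1 h2
    simpa [h2] using h1.symm
  have h0z : Tendsto (fun z : ℂ => ((0, z) : ℂ × ℂ)) (𝓝 0) (𝓝 0) :=
    Continuous.tendsto' (by fun_prop) _ _ rfl
  have hρ00 : ρ (0, 0) = 0 := by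
    have h1 : Tendsto (fun z => ρ (0, z)) (𝓝[≠] 0) (𝓝 (ρ 0)) :=
      (hρ.continuousAt.tendsto.comp h0z).mono_left nhdsWithin_le_nhds
    refine tendsto_nhds_unique h1 (tendsto_const_nhds.congr' ?_)
    filter_upwards [nhdsWithin_le_nhds (h0z.eventually hrρ), self_mem_nhdsWithin,
      nhdsWithin_le_nhds (hz0.eventually hQ2)] with z h2 h3 h4
    have h5 : z ^ s ≠ 0 := pow_ne_zero _ h3
    have h6 : z ^ s * ρ (0, z) = 0 := by simpa [h4] using h2.symm
    exact ((mul_eq_zero.1 h6).resolve_left h5).symm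
  have hρz := AnalyticAt.eventually_ne_zero_and_deriv_ne_zero (f := fun z => ρ (z, 0))
    (AnalyticAt.comp (f := fun x : ℂ => (x, (0 : ℂ))) hρ (analyticAt_id.prod analyticAt_const))
    hρ00 hρ0
  have t0 : Tendsto (fun p : ℂ × ℂ => ((p.1, p.2, 0) : ℂ × ℂ × ℂ)) (𝓝 0) (𝓝 0) :=
    Continuous.tendsto' (by fun_prop) _ _ rfl
  have tQ : Tendsto (fun p : ℂ × ℂ => Q (p.1, p.2, 0)) (𝓝 0) (𝓝 0) := by
    simpa [hQ0, Function.comp_def] using hQ.continuousAt.tendsto.comp t0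
  have t1 : Tendsto (fun p : ℂ × ℂ => (p.1, Q (p.1, p.2, 0))) (𝓝 0) (𝓝 0) :=
    (continuous_fst.tendsto' (0 : ℂ × ℂ) 0 rfl).prodMk_nhds tQ
  have hF0 : F 0 = 0 := hz.self_of_nhds.1
  have t2 : Tendsto (fun p : ℂ × ℂ => F (p.1, Q (p.1, p.2, 0))) (𝓝 0) (𝓝 0) := by
    simpa [hF0, Function.comp_def] using hF.continuousAt.tendsto.comp t1
  have t3 : Tendsto (fun p : ℂ × ℂ => (F (p.1, Q (p.1, p.2, 0)), p.2)) (𝓝 0) (𝓝 0) :=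
    t2.prodMk_nhds (continuous_snd.tendsto' (0 : ℂ × ℂ) 0 rfl)
  have t4 : Tendsto (fun p : ℂ × ℂ => cj p.2) (𝓝 0) (𝓝 0) :=
    tendsto_cj_zero.comp (continuous_snd.tendsto' (0 : ℂ × ℂ) 0 rfl)
  have t5 : Tendsto (fun p : ℂ × ℂ => (cj p.2, (0 : ℂ))) (𝓝 0) (𝓝 0) :=
    t4.prodMk_nhds tendsto_const_nhds
  have hcurry : ∀ {P : ℂ × ℂ → Prop}, (∀ᶠ p in 𝓝 (0 : ℂ × ℂ), P p) →
      ∀ᶠ x in 𝓝[≠] (0 : ℂ), ∀ᶠ z in 𝓝 (0 : ℂ), P (x, z) := fun h =>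
    nhdsWithin_le_nhds (Filter.Eventually.curry_nhds (x := (0 : ℂ)) (y := (0 : ℂ)) h)
  have hAz := nhdsWithin_le_nhds (s := {0}ᶜ) (hz0.eventually hA.eventually_analyticAt)
  have hBz := nhdsWithin_le_nhds (s := {0}ᶜ) (hz0.eventually hB.eventually_analyticAt)
  have hρa := nhdsWithin_le_nhds (s := {0}ᶜ) (hz0.eventually hρ.eventually_analyticAt)
  have sec : ∀ {f : ℂ × ℂ → ℂ} {z : ℂ}, AnalyticAt ℂ f (z, 0) →
      AnalyticAt ℂ (fun w => f (z, w)) 0 := fun {f z} hf =>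
    AnalyticAt.comp (g := f) (f := fun w : ℂ => (z, w)) hf (analyticAt_const.prod analyticAt_id)
  have first : ∀ᶠ z in 𝓝[≠] (0 : ℂ), B (z, 0) = 0 ∧
      ρ (z, 0) * deriv (fun w => B (z, w)) 0 = fderiv ℂ ρ (z, 0) (1, 0) * A (z, 0) := by
    have ev : ∀ᶠ p : ℂ × ℂ in 𝓝 0, (p.2 ^ s * ρ p) ^ k * B (p.1, p.2 ^ s * ρ p) =
        p.2 ^ s * (ρ (p.1 + (p.2 ^ s * ρ p) ^ k * A (p.1, p.2 ^ s * ρ p), p.2) - ρ p) := by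
      filter_upwards [t0.eventually hmap, hrρ, t3.eventually hrρ, t4.eventually hz,
        t1.eventually hFA, t1.eventually hGB] with p h1 h2 h3 h4 h5 h6
      simp only [cj_zero, h4.1, h4.2, cj_cj] at h1
      rw [← h2]
      have h7 : F (p.1, Q (p.1, p.2, 0)) =
          p.1 + Q (p.1, p.2, 0) ^ k * A (p.1, Q (p.1, p.2, 0)) := by linear_combination h5
      rw [← h7]
      linear_combination -h6 + h1 + h3 - h2
    filter_upwards [hcurry ev, hAz, hBz, hρa, hρz] with z h1 h2 h3 h4 h5
    exact pushforward_first_relation hs hk h4 h5.1 (sec h2).continuousAt (sec h3).differentiableAt h1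
  have hBzero : ∀ᶠ z in 𝓝 (0 : ℂ), B (z, 0) = 0 := ext0 B hB (first.mono fun z h => h.1)
  have hAo : k = 1 → (fun x => A (x, 0)) =o[𝓝 0] fun x : ℂ => x := fun hk1 =>
    isLittleO_of_snd_mul_isBigO hA (hFO.congr' (hFA.mono fun p hp => by simpa [hk1] using hp)
      EventuallyEq.rfl)
  set v : ℂ × ℂ → ℂ := fun p => fderiv ℂ Q (p.1, p.2, 0) (0, 0, 1) with hv
  have hva : AnalyticAt ℂ v 0 := AnalyticAt.comp (g := fun q => fderiv ℂ Q q (0, 0, 1))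
    (f := fun p : ℂ × ℂ => (p.1, p.2, (0 : ℂ))) (hQ.fderiv_apply_const _)
      (analyticAt_fst.prod (analyticAt_snd.prod analyticAt_const))
  have hv1 : ∀ᶠ z in 𝓝 (0 : ℂ), v (z, 0) = 1 := by
    filter_upwards [(t0.comp hz0).eventually hQ.eventually_analyticAt,
      hz0.eventually hQ1.eventually_nhds] with z h1 h2
    have d1 : HasDerivAt (fun τ => Q (z, 0, τ)) (v (z, 0)) 0 :=
      h1.differentiableAt.hasFDerivAt.comp_hasDerivAt (f := fun τ => (z, (0 : ℂ), τ)) 0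
        ((hasDerivAt_const _ _).prodMk ((hasDerivAt_const _ _).prodMk (hasDerivAt_id _)))
    refine d1.unique ((hasDerivAt_id (0 : ℂ)).congr_of_eventuallyEq ?_)
    have h4 : Tendsto (fun w : ℂ => (z, w)) (𝓝 0) (𝓝 (z, 0)) :=
      Continuous.tendsto' (by fun_prop) _ _ rfl
    exact h4.eventually h2
  have hFw := fderiv_snd_eq_of_eventually_eq_pow_mul (g := fun p => p.1) (c := 0) hF hA
    (fun p => hasDerivAt_const _ _) hFA
  have hGw := fderiv_snd_eq_of_eventually_eq_pow_mul (g := fun p => p.2) (c := 1) hG hB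
    (fun p => hasDerivAt_id _) hGB
  have hQz : ∀ᶠ p : ℂ × ℂ in 𝓝 0,
      fderiv ℂ Q (p.1, p.2, 0) (1, 0, 0) = p.2 ^ s * fderiv ℂ ρ p (1, 0) ∧
      fderiv ℂ Q (p.1, p.2, 0) (0, 1, 0) =
        s * p.2 ^ (s - 1) * ρ p + p.2 ^ s * fderiv ℂ ρ p (0, 1) := by
    filter_upwards [t0.eventually hQ.eventually_analyticAt, hρ.eventually_analyticAt,
      hrρ.eventually_nhds] with p h1 h2 h3
    have e1 : Tendsto (fun y : ℂ => (y, p.2)) (𝓝 p.1) (𝓝 p) :=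
      Continuous.tendsto' (by fun_prop) _ _ rfl
    have e2 : Tendsto (fun y : ℂ => (p.1, y)) (𝓝 p.2) (𝓝 p) :=
      Continuous.tendsto' (by fun_prop) _ _ rfl
    have d1 : HasDerivAt (fun y => Q (y, p.2, 0)) (fderiv ℂ Q (p.1, p.2, 0) (1, 0, 0)) p.1 :=
      h1.differentiableAt.hasFDerivAt.comp_hasDerivAt (f := fun y => (y, p.2, (0 : ℂ))) p.1
        ((hasDerivAt_id _).prodMk ((hasDerivAt_const _ _).prodMk (hasDerivAt_const _ _)))
    have d2 : HasDerivAt (fun y => Q (p.1, y, 0)) (fderiv ℂ Q (p.1, p.2, 0) (0, 1, 0)) p.2 :=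
      h1.differentiableAt.hasFDerivAt.comp_hasDerivAt (f := fun y => (p.1, y, (0 : ℂ))) p.2
        ((hasDerivAt_const _ _).prodMk ((hasDerivAt_id _).prodMk (hasDerivAt_const _ _)))
    exact ⟨d1.unique ((h2.hasDerivAt_fst.const_mul _).congr_of_eventuallyEq (e1.eventually h3)),
      d2.unique (((hasDerivAt_pow s p.2).mul h2.hasDerivAt_snd).congr_of_eventuallyEq
        (e2.eventually h3))⟩
  have second : ∀ᶠ z in 𝓝[≠] (0 : ℂ), (k + 1) * (ρ (z, 0) * deriv (fun w => B (z, w)) 0) =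
      k * (fderiv ℂ ρ (z, 0) (1, 0) * A (z, 0)) := by
    set X : ℂ → ℂ → ℂ := fun z x =>
      (s * x ^ (s - 1) * ρ (z + (x ^ s * ρ (z, x)) ^ k * A (z, x ^ s * ρ (z, x)), x) +
        x ^ s * fderiv ℂ ρ (z + (x ^ s * ρ (z, x)) ^ k * A (z, x ^ s * ρ (z, x)), x) (0, 1)) *
      cj (k * 0 ^ (k - 1) * A (cj x, 0)) with hX
    have ev : ∀ᶠ p : ℂ × ℂ in 𝓝 0, ∀ r y, r = p.2 ^ s * ρ p → y = p.1 + r ^ k * A (p.1, r) →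
        (k * r ^ (k - 1) * B (p.1, r) + r ^ k * deriv (fun w => B (p.1, w)) r) * v p =
        p.2 ^ s * fderiv ℂ ρ (y, p.2) (1, 0) *
          ((k * r ^ (k - 1) * A (p.1, r) + r ^ k * deriv (fun w => A (p.1, w)) r) * v p) +
          X p.1 p.2 + (v (y, p.2) - v p) := by
      filter_upwards [mapping_identity_deriv hQ hQ0 hF hG hz hmap, hrρ, t1.eventually hFA,
        t1.eventually hFw, t1.eventually hGw, t3.eventually hQz, t5.eventually hFw,
        t5.eventually hGw, t4.eventually hBzero]
        with p h1 h2 h3 h4 h5 h6 h7 h8 h9 r y hr hy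
      have hr' : r = Q (p.1, p.2, 0) := by rw [hr, h2]
      simp only [← hr'] at h3 h4 h5 h6
      have hyF : y = F (p.1, r) := by rw [hy]; linear_combination -h3
      rw [← hyF] at h6
      have h1 := h1 r y hr' hyF
      rw [h4, h5, h6.1, h6.2, h7, h8, h9] at h1
      have hXp : X p.1 p.2 = (s * p.2 ^ (s - 1) * ρ (y, p.2) +
          p.2 ^ s * fderiv ℂ ρ (y, p.2) (0, 1)) * cj (k * 0 ^ (k - 1) * A (cj p.2, 0)) := by
        simp only [hX, hy, hr]
      rw [hXp]
      simp only [zero_pow hk, zero_mul, mul_zero, add_zero, zero_add, cj_one, mul_one] at h1 ⊢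
      change _ * v p = _ * (_ * v p) + _ + v (y, p.2) at h1
      linear_combination h1
    have hXo : ∀ᶠ z in 𝓝[≠] (0 : ℂ),
        X z =o[𝓝[≠] 0] fun x => x ^ s * (x ^ s * ρ (z, x)) ^ (k - 1) := by
      rcases eq_or_ne k 1 with hk1 | hk1
      · filter_upwards [hAz, hρa] with z h1 h2
        have hid : Tendsto (fun x : ℂ => x) (𝓝[≠] 0) (𝓝 0) :=
          tendsto_id.mono_left nhdsWithin_le_nhds
        have hxs : Tendsto (fun x : ℂ => x ^ s) (𝓝[≠] 0) (𝓝 0) :=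
          ((continuous_pow s).tendsto' 0 0 (by simp [hs])).mono_left nhdsWithin_le_nhds
        have c1 : Tendsto (fun x => ρ (z, x)) (𝓝[≠] 0) (𝓝 (ρ (z, 0))) :=
          (sec h2).continuousAt.tendsto.mono_left nhdsWithin_le_nhds
        have c2 : Tendsto (fun x => x ^ s * ρ (z, x)) (𝓝[≠] 0) (𝓝 0) := by
          simpa using hxs.mul c1
        have c3 : Tendsto (fun x => A (z, x ^ s * ρ (z, x))) (𝓝[≠] 0) (𝓝 (A (z, 0))) :=
          (sec h1).continuousAt.tendsto.comp c2
        have c4 : Tendsto (fun x => z + (x ^ s * ρ (z, x)) ^ k * A (z, x ^ s * ρ (z, x)))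
            (𝓝[≠] 0) (𝓝 z) := by
          simpa [hk] using ((c2.pow k).mul c3).const_add z
        have c5 := c4.prodMk_nhds hid
        have c6 := (h2.continuousAt.tendsto.comp c5).isBigO_one ℂ
        have c7 := ((h2.fderiv_apply_const (0, 1)).continuousAt.tendsto.comp c5).isBigO_one ℂ
        have c8 : (fun x => cj (A (cj x, 0))) =o[𝓝[≠] 0] fun x : ℂ => x := by
          have h3 := ((hAo hk1).comp_tendsto tendsto_cj_zero).mono
            (nhdsWithin_le_nhds (s := {0}ᶜ))
          rw [← Asymptotics.isLittleO_norm_norm] at h3 ⊢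
          simpa using h3
        have c9 : (fun x : ℂ => x ^ s) =O[𝓝[≠] 0] fun x => x ^ (s - 1) := by
          have h4 := (Asymptotics.isBigO_refl (fun x : ℂ => x ^ (s - 1)) (𝓝[≠] 0)).mul
            (hid.isBigO_one ℂ)
          refine h4.congr (fun x => ?_) fun x => mul_one _
          rw [← pow_succ, Nat.sub_add_cancel (Nat.one_le_iff_ne_zero.2 hs)]
        have c10 := ((((Asymptotics.isBigO_refl (fun x : ℂ => x ^ (s - 1)) (𝓝[≠] 0)).const_mul_left
          (s : ℂ)).mul c6).add (c9.mul c7)).mul_isLittleO c8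
        refine c10.congr (fun x => ?_) fun x => ?_
        · simp [hX, hk1]
        · simp only [hk1, Nat.sub_self, pow_zero, mul_one]
          rw [← pow_succ, Nat.sub_add_cancel (Nat.one_le_iff_ne_zero.2 hs)]
      · refine Eventually.of_forall fun z => ?_
        have : X z = 0 := by
          funext x
          have : k - 1 ≠ 0 := by omega
          simp [hX, this]
        rw [this]
        exact Asymptotics.isLittleO_zero _ _
    filter_upwards [hcurry ev, hAz, hBz, hρa, hρz, nhdsWithin_le_nhds hBzero, hXo,
      nhdsWithin_le_nhds (hz0.eventually hva.eventually_analyticAt),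
      nhdsWithin_le_nhds hv1.eventually_nhds] with z h1 h2 h3 h4 h5 h6 h7 h8 h9
    exact pushforward_second_relation hs hk h4 h5.1 (sec h2) (sec h3) h6 h8 h9 h7 h1
  have hAzero : ∀ᶠ z in 𝓝 (0 : ℂ), A (z, 0) = 0 := by
    refine ext0 A hA ?_
    filter_upwards [first, second, hρz, hρa] with z h1 h2 h3 h4
    have h5 : fderiv ℂ ρ (z, 0) (1, 0) * A (z, 0) = 0 := by
      linear_combination h2 - (k + 1) * h1.2
    refine (mul_eq_zero.1 h5).resolve_left fun h6 => h3.2 ?_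
    exact h4.hasDerivAt_fst.deriv.trans h6
  exact hD0 (by filter_upwards [hAzero, hBzero] with z h1 h2 using Prod.ext h1 h2)

theorem AnalyticAt.exists_eq_add_mul {f : ℂ → ℂ} (hf : AnalyticAt ℂ f 0) :
    ∃ g, AnalyticAt ℂ g 0 ∧ ∀ z, f z = f 0 + z * g z := by
  obtain ⟨p, hp⟩ := hf
  refine ⟨dslope f 0, hp.has_fpower_series_dslope_fslope.analyticAt, fun z => ?_⟩
  have := sub_smul_dslope f 0 z
  rw [sub_zero, smul_eq_mul] at this
  rw [this]; ring

/-- Derivatives up to order two at `0` of `c + w * h w`. -/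
theorem deriv_deriv_two_of_eventually_eq {f h : ℂ → ℂ} {c : ℂ} (hh : AnalyticAt ℂ h 0)
    (hf : ∀ᶠ w in 𝓝 0, f w = c + w * h w) :
    f 0 = c ∧ deriv f 0 = h 0 ∧ deriv^[2] f 0 = 2 * deriv h 0 := by
  have h1 : ∀ᶠ w in 𝓝 0, deriv f w = h w + w * deriv h w := by
    filter_upwards [hf.eventually_nhds, hh.eventually_analyticAt] with w h1 h2
    have h3 := ((hasDerivAt_id w).mul h2.differentiableAt.hasDerivAt).const_add c
    rw [(h3.congr_of_eventuallyEq h1).deriv]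
    simp
  refine ⟨by simpa using hf.self_of_nhds, by simpa using h1.self_of_nhds, ?_⟩
  have h3 := hh.differentiableAt.hasDerivAt.add
    ((hasDerivAt_id (0 : ℂ)).mul hh.deriv.differentiableAt.hasDerivAt)
  change deriv (deriv f) 0 = _
  rw [(h3.congr_of_eventuallyEq h1).deriv]
  simp
  ring

/-- Taylor expansion of order two in two variables, in terms of `pd`. -/
theorem isBigO_sub_taylor_two {F : ℂ → ℂ → ℂ} (hF : AnalyticAt ℂ (fun p : ℂ × ℂ => F p.1 p.2) 0) :
    (fun p : ℂ × ℂ => F p.1 p.2 - (pd F 0 0 0 0 + pd F 1 0 0 0 * p.1 + pd F 0 1 0 0 * p.2 +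
      pd F 2 0 0 0 / 2 * p.1 ^ 2 + pd F 1 1 0 0 * (p.1 * p.2) + pd F 0 2 0 0 / 2 * p.2 ^ 2))
      =O[𝓝 0] fun p => ‖p‖ ^ 3 := by
  have sec : ∀ {f : ℂ × ℂ → ℂ}, AnalyticAt ℂ f 0 → AnalyticAt ℂ (fun z => f (z, 0)) 0 :=
    fun {f} hf => AnalyticAt.comp (g := f) (f := fun z : ℂ => (z, (0 : ℂ))) hf
      (analyticAt_id.prod analyticAt_const)
  have hz0 : Tendsto (fun z : ℂ => ((z, 0) : ℂ × ℂ)) (𝓝 0) (𝓝 0) :=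
    Continuous.tendsto' (by fun_prop) _ _ rfl
  obtain ⟨g₁, hg₁, e₁⟩ := hF.exists_eq_add_snd_smul
  obtain ⟨g₂, hg₂, e₂⟩ := hg₁.exists_eq_add_snd_smul
  obtain ⟨g₃, hg₃, e₃⟩ := hg₂.exists_eq_add_snd_smul
  simp only [smul_eq_mul] at e₁ e₂ e₃
  have hcurry : ∀ {P : ℂ × ℂ → Prop}, (∀ᶠ p in 𝓝 (0 : ℂ × ℂ), P p) →
      ∀ᶠ x in 𝓝 (0 : ℂ), ∀ᶠ z in 𝓝 (0 : ℂ), P (x, z) := fun h =>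
    Filter.Eventually.curry_nhds (x := (0 : ℂ)) (y := (0 : ℂ)) h
  have sec' : ∀ {f : ℂ × ℂ → ℂ} {z : ℂ}, AnalyticAt ℂ f (z, 0) →
      AnalyticAt ℂ (fun w => f (z, w)) 0 := fun {f z} hf =>
    AnalyticAt.comp (g := f) (f := fun w : ℂ => (z, w)) hf (analyticAt_const.prod analyticAt_id)
  have d : ∀ᶠ z in 𝓝 (0 : ℂ), deriv (F z) 0 = g₁ (z, 0) ∧ deriv^[2] (F z) 0 = 2 * g₂ (z, 0) := by
    filter_upwards [hcurry e₁, hcurry e₂, hz0.eventually hg₁.eventually_analyticAt,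
      hz0.eventually hg₂.eventually_analyticAt] with z h1 h2 h3 h4
    have h5 := deriv_deriv_two_of_eventually_eq (sec' h3) h1
    have h6 := deriv_deriv_two_of_eventually_eq (sec' h4) h2
    exact ⟨h5.2.1, by rw [h5.2.2, h6.2.1]⟩
  obtain ⟨a₁, ha₁, c₁⟩ := (sec hF).exists_eq_add_mul
  obtain ⟨a₂, ha₂, c₂⟩ := ha₁.exists_eq_add_mul
  obtain ⟨a₃, ha₃, c₃⟩ := ha₂.exists_eq_add_mul
  obtain ⟨b₁, hb₁, k₁⟩ := (sec hg₁).exists_eq_add_mul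
  obtain ⟨b₂, hb₂, k₂⟩ := hb₁.exists_eq_add_mul
  obtain ⟨l₁, hl₁, m₁⟩ := (sec hg₂).exists_eq_add_mul
  have p00 : pd F 0 0 0 0 = F 0 0 := rfl
  have p10 : pd F 1 0 0 0 = a₁ 0 :=
    (deriv_deriv_two_of_eventually_eq ha₁ (Eventually.of_forall c₁)).2.1
  have p20 : pd F 2 0 0 0 = 2 * a₂ 0 :=
    (deriv_deriv_two_of_eventually_eq ha₁ (Eventually.of_forall c₁)).2.2.trans (by
      rw [(deriv_deriv_two_of_eventually_eq ha₂ (Eventually.of_forall c₂)).2.1])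
  have p01 : pd F 0 1 0 0 = g₁ (0, 0) := d.self_of_nhds.1
  have p02 : pd F 0 2 0 0 = 2 * g₂ (0, 0) := d.self_of_nhds.2
  have p11 : pd F 1 1 0 0 = b₁ 0 := by
    have h1 : ∀ᶠ z in 𝓝 (0 : ℂ), deriv (F z) 0 = g₁ (0, 0) + z * b₁ z := by
      filter_upwards [d] with z hz
      rw [hz.1, k₁]
    exact (deriv_deriv_two_of_eventually_eq hb₁ h1).2.1
  rw [p00, p10, p20, p01, p02, p11]
  have O1 : (fun p : ℂ × ℂ => p.1) =O[𝓝 0] fun p => ‖p‖ :=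
    Asymptotics.isBigO_fst_prod.norm_right
  have O2 : (fun p : ℂ × ℂ => p.2) =O[𝓝 0] fun p => ‖p‖ :=
    Asymptotics.isBigO_snd_prod.norm_right
  have one : ∀ {f : ℂ → ℂ}, AnalyticAt ℂ f 0 →
      (fun p : ℂ × ℂ => f p.1) =O[𝓝 0] fun _ => (1 : ℝ) := fun {f} hf =>
    (hf.continuousAt.tendsto.comp (continuous_fst.tendsto' (0 : ℂ × ℂ) 0 rfl)).isBigO_one ℝ
  have T := ((((O1.pow 3).mul (one ha₃)).add (((O2.mul (O1.pow 2))).mul (one hb₂) |>.congr_right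
    fun p => by ring)).add (((O2.pow 2).mul O1).mul (one hl₁) |>.congr_right
    fun p => by ring)).add ((O2.pow 3).mul (hg₃.continuousAt.tendsto.isBigO_one ℝ))
  refine T.congr' ?_ (Eventually.of_forall fun p => mul_one _)
  filter_upwards [e₁, e₂, e₃] with p h1 h2 h3
  have c₁ := c₁ p.1
  have c₂ := c₂ p.1
  have c₃ := c₃ p.1
  have k₁ := k₁ p.1
  have k₂ := k₂ p.1
  have m₁ := m₁ p.1
  simp only at c₁ k₁ m₁ h1 h2 h3
  rw [h1, h2, h3, c₁, c₂, c₃, k₁, k₂, m₁]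
  ring

/-- Analytic inverse function theorem for germs at `0` of maps of `ℂ²`. -/
theorem exists_local_inverse {Φ : ℂ × ℂ → ℂ × ℂ} (hΦ : AnalyticAt ℂ Φ 0) (h0 : Φ 0 = 0)
    {a b c d : ℂ} (h1 : fderiv ℂ Φ 0 (1, 0) = (a, c)) (h2 : fderiv ℂ Φ 0 (0, 1) = (b, d))
    (hdet : a * d - b * c ≠ 0) :
    ∃ K, AnalyticAt ℂ K 0 ∧ K 0 = 0 ∧ (∀ᶠ p in 𝓝 0, K (Φ p) = p) ∧ ∀ᶠ p in 𝓝 0, Φ (K p) = p := by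
  set L := fderiv ℂ Φ 0 with hL
  have hLx : ∀ x y : ℂ, L (x, y) = (x * a + y * b, x * c + y * d) := fun x y => by
    have : ((x, y) : ℂ × ℂ) = x • ((1 : ℂ), (0 : ℂ)) + y • ((0 : ℂ), (1 : ℂ)) := by simp
    rw [this, map_add, map_smul, map_smul, h1, h2]
    simp
  have hinj : Function.Injective (L : ℂ × ℂ →ₗ[ℂ] ℂ × ℂ) := by
    rw [injective_iff_map_eq_zero]
    rintro ⟨x, y⟩ hxy
    have hxy : L (x, y) = 0 := hxy
    rw [hLx, Prod.mk_eq_zero] at hxy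
    have hx : x * (a * d - b * c) = 0 := by linear_combination d * hxy.1 - b * hxy.2
    have hy : y * (a * d - b * c) = 0 := by linear_combination a * hxy.2 - c * hxy.1
    simpa [hdet, Prod.ext_iff] using And.intro hx hy
  set e : (ℂ × ℂ) ≃L[ℂ] ℂ × ℂ := (LinearEquiv.ofInjectiveEndo _ hinj).toContinuousLinearEquiv
  have he : HasFDerivAt Φ (e : ℂ × ℂ →L[ℂ] ℂ × ℂ) 0 := by
    have h3 : (e : ℂ × ℂ →L[ℂ] ℂ × ℂ) = L := by
      ext <;> rfl
    rw [h3]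
    exact hΦ.differentiableAt.hasFDerivAt
  have hcd : ContDiffAt ℂ ⊤ Φ 0 := hΦ.contDiffAt
  have hn : (⊤ : WithTop ℕ∞) ≠ 0 := by simp
  refine ⟨hcd.localInverse he hn, ?_, ?_, ?_, ?_⟩
  · have := hcd.to_localInverse he hn
    rw [h0] at this
    exact this.analyticAt
  · have := hcd.localInverse_apply_image he hn
    rwa [h0] at this
  · exact (hcd.hasStrictFDerivAt' he hn).eventually_left_inverse
  · have := (hcd.hasStrictFDerivAt' he hn).eventually_right_inverse
    rwa [h0] at this

theorem pd_one_zero_eq_fderiv {F : ℂ → ℂ → ℂ} (hF : AnalyticAt ℂ (fun p : ℂ × ℂ => F p.1 p.2) 0) :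
    pd F 1 0 0 0 = fderiv ℂ (fun p : ℂ × ℂ => F p.1 p.2) 0 (1, 0) :=
  hF.hasDerivAt_fst.deriv

theorem pd_zero_one_eq_fderiv {F : ℂ → ℂ → ℂ} (hF : AnalyticAt ℂ (fun p : ℂ × ℂ => F p.1 p.2) 0) :
    pd F 0 1 0 0 = fderiv ℂ (fun p : ℂ × ℂ => F p.1 p.2) 0 (0, 1) :=
  hF.hasDerivAt_snd.deriv

theorem isBigO_sub_of_pd_eq {F₁ F₂ : ℂ → ℂ → ℂ}
    (h₁ : AnalyticAt ℂ (fun p : ℂ × ℂ => F₁ p.1 p.2) 0)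
    (h₂ : AnalyticAt ℂ (fun p : ℂ × ℂ => F₂ p.1 p.2) 0)
    (h : ∀ i j : ℕ, i + j ≤ 2 → pd F₁ i j 0 0 = pd F₂ i j 0 0) :
    (fun p : ℂ × ℂ => F₁ p.1 p.2 - F₂ p.1 p.2) =O[𝓝 0] fun p => ‖p‖ ^ 3 := by
  refine ((isBigO_sub_taylor_two h₁).sub (isBigO_sub_taylor_two h₂)).congr_left fun p => ?_
  rw [h 0 0 (by norm_num), h 1 0 (by norm_num), h 0 1 (by norm_num), h 2 0 (by norm_num),
    h 1 1 (by norm_num), h 0 2 (by norm_num)]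
  ring

theorem pd_one_zero_snd_eq_zero {Q Q' : ℂ → ℂ → ℂ → ℂ} {F G : ℂ → ℂ → ℂ}
    (hQ : IsNormalCoord Q) (hQ' : IsNormalCoord Q') (h : SendsInto Q Q' F G) :
    pd G 1 0 0 0 = 0 := by
  obtain ⟨hF, hG, hF0, hG0, hmap⟩ := h
  have t1 : Tendsto (fun z : ℂ => ((z, 0, 0) : ℂ × ℂ × ℂ)) (𝓝 0) (𝓝 0) :=
    Continuous.tendsto' (by fun_prop) _ _ rfl
  have t2 : Tendsto (fun z : ℂ => ((z, 0) : ℂ × ℂ)) (𝓝 0) (𝓝 0) :=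
    Continuous.tendsto' (by fun_prop) _ _ rfl
  have t3 : Tendsto (fun z : ℂ => F z 0) (𝓝 0) (𝓝 0) := by
    have := hF.continuousAt.tendsto.comp t2
    simpa [Function.comp_def, hF0] using this
  have t4 : Tendsto (fun z : ℂ => (F z 0, (0 : ℂ))) (𝓝 0) (𝓝 0) :=
    t3.prodMk_nhds tendsto_const_nhds
  have h1 : ∀ᶠ z in 𝓝 (0 : ℂ), G z 0 = 0 := by
    filter_upwards [t1.eventually hmap, t2.eventually hQ.2.1, t4.eventually hQ'.2.1]
      with z h1 h2 h3
    simpa [h2, hF0, hG0, h3] using h1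
  exact ((hasDerivAt_const (0 : ℂ) (0 : ℂ)).congr_of_eventuallyEq h1).deriv

/-- The equation `G (z, w) = Q' (F (z, w), χ', τ')` has at most one small solution `w`. -/
theorem eventually_snd_eq_of_defining_eq {Q' : ℂ → ℂ → ℂ → ℂ} {F G : ℂ → ℂ → ℂ}
    (hQ' : IsNormalCoord Q') (hF : AnalyticAt ℂ (fun p : ℂ × ℂ => F p.1 p.2) 0)
    (hG : AnalyticAt ℂ (fun p : ℂ × ℂ => G p.1 p.2) 0) (hF0 : F 0 0 = 0)
    (hGw : pd G 0 1 0 0 ≠ 0) :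
    ∀ᶠ u : (ℂ × ℂ) × ℂ × ℂ × ℂ in 𝓝 0,
      G u.1.1 u.2.1 = Q' (F u.1.1 u.2.1) u.2.2.1 u.2.2.2 →
      G u.1.1 u.1.2 = Q' (F u.1.1 u.1.2) u.2.2.1 u.2.2.2 → u.1.2 = u.2.1 := by
  set S : (ℂ × ℂ) × ℂ × ℂ → ℂ := fun u => G u.1.1 u.1.2 - Q' (F u.1.1 u.1.2) u.2.1 u.2.2 with hS
  have hSa : AnalyticAt ℂ S 0 := by
    refine AnalyticAt.sub (AnalyticAt.comp (g := fun p : ℂ × ℂ => G p.1 p.2)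
      (f := fun u : (ℂ × ℂ) × ℂ × ℂ => u.1) hG analyticAt_fst) ?_
    refine AnalyticAt.comp (g := fun p : ℂ × ℂ × ℂ => Q' p.1 p.2.1 p.2.2)
      (f := fun u : (ℂ × ℂ) × ℂ × ℂ => (F u.1.1 u.1.2, u.2)) ?_ ?_
    · simpa [hF0, Prod.mk_zero_zero] using hQ'.1
    · exact (AnalyticAt.comp (g := fun p : ℂ × ℂ => F p.1 p.2)
        (f := fun u : (ℂ × ℂ) × ℂ × ℂ => u.1) hF analyticAt_fst).prod analyticAt_snd
  set L := fderiv ℂ S 0 with hL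
  have hLw : L ((0, 1), 0) = pd G 0 1 0 0 := by
    have d1 : HasDerivAt (fun w => S ((0, w), 0)) (L ((0, 1), 0)) 0 :=
      hSa.differentiableAt.hasFDerivAt.comp_hasDerivAt
        (f := fun w : ℂ => (((0 : ℂ), w), (0 : ℂ × ℂ))) (0 : ℂ)
        (((hasDerivAt_const _ _).prodMk (hasDerivAt_id _)).prodMk (hasDerivAt_const _ _))
    have t2 : Tendsto (fun z : ℂ => ((0, z) : ℂ × ℂ)) (𝓝 0) (𝓝 0) :=
      Continuous.tendsto' (by fun_prop) _ _ rfl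
    have t3 : Tendsto (fun z : ℂ => F 0 z) (𝓝 0) (𝓝 0) := by
      have := hF.continuousAt.tendsto.comp t2
      simpa [Function.comp_def, hF0] using this
    have t4 : Tendsto (fun z : ℂ => (F 0 z, (0 : ℂ))) (𝓝 0) (𝓝 0) :=
      t3.prodMk_nhds tendsto_const_nhds
    rw [← d1.deriv]
    refine (EventuallyEq.deriv_eq (f₁ := fun w => S ((0, w), 0)) (f := fun w => G 0 w) ?_)
    filter_upwards [t4.eventually hQ'.2.1] with w hw
    simp [hS, hw]
  have hpos : 0 < ‖pd G 0 1 0 0‖ / 2 := half_pos (norm_pos_iff.2 hGw)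
  have hb := hSa.hasStrictFDerivAt.isLittleO.def hpos
  have t : Tendsto (fun u : (ℂ × ℂ) × ℂ × ℂ × ℂ => ((u.1, u.2.2), ((u.1.1, u.2.1), u.2.2)))
      (𝓝 0) (𝓝 ((0 : (ℂ × ℂ) × ℂ × ℂ), (0 : (ℂ × ℂ) × ℂ × ℂ))) :=
    Continuous.tendsto' (by fun_prop) _ _ rfl
  filter_upwards [t.eventually hb] with u hu h1 h2
  have e1 : S (u.1, u.2.2) = 0 := sub_eq_zero.2 h2
  have e2 : S ((u.1.1, u.2.1), u.2.2) = 0 := sub_eq_zero.2 h1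
  have e3 : ((u.1, u.2.2) - ((u.1.1, u.2.1), u.2.2) : (ℂ × ℂ) × ℂ × ℂ) =
      (u.1.2 - u.2.1) • (((0 : ℂ), (1 : ℂ)), (0 : ℂ × ℂ)) := by
    simp [Prod.ext_iff]
  rw [e1, e2, e3, map_smul, ← hL, hLw, smul_eq_mul, sub_self, zero_sub, norm_neg, norm_mul,
    norm_smul] at hu
  have e4 : ‖(((0 : ℂ), (1 : ℂ)), (0 : ℂ × ℂ))‖ = 1 := by simp [Prod.norm_def]
  rw [e4] at hu
  have e5 : ‖u.1.2 - u.2.1‖ = 0 := by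
    nlinarith [norm_nonneg (u.1.2 - u.2.1)]
  exact sub_eq_zero.1 (norm_eq_zero.1 e5)

/-- local biholomorphisms between real-analytic hypersurfaces of finite
type in `ℂ²` (in normal coordinates) are uniquely determined by their `2`-jets at `0`. -/
theorem two_jet_determination_finite_type
    (Q Q' : ℂ → ℂ → ℂ → ℂ) (hQ : IsNormalCoord Q) (hQ' : IsNormalCoord Q')
    (hFT : FiniteTypeAt Q) (hFT' : FiniteTypeAt Q')
    (F₁ G₁ F₂ G₂ : ℂ → ℂ → ℂ)
    (h₁ : SendsInto Q Q' F₁ G₁) (h₂ : SendsInto Q Q' F₂ G₂)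
    (hb₁ : JacDet F₁ G₁ ≠ 0) (hb₂ : JacDet F₂ G₂ ≠ 0)
    (hjet : ∀ i j : ℕ, i + j ≤ 2 →
      pd F₁ i j 0 0 = pd F₂ i j 0 0 ∧ pd G₁ i j 0 0 = pd G₂ i j 0 0) :
    ∀ᶠ p : ℂ × ℂ in 𝓝 0, F₁ p.1 p.2 = F₂ p.1 p.2 ∧ G₁ p.1 p.2 = G₂ p.1 p.2 := by
  have hGz := pd_one_zero_snd_eq_zero hQ hQ' h₂
  obtain ⟨hF₁, hG₁, hF₁0, hG₁0, hm₁⟩ := h₁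
  obtain ⟨hF₂, hG₂, hF₂0, hG₂0, hm₂⟩ := h₂
  have hGw : pd G₂ 0 1 0 0 ≠ 0 := fun h => hb₂ (by simp [JacDet, h, hGz])
  have hdet := hb₂
  unfold JacDet at hdet
  set Φ₁ : ℂ × ℂ → ℂ × ℂ := fun p => (F₁ p.1 p.2, G₁ p.1 p.2) with hΦ₁
  set Φ₂ : ℂ × ℂ → ℂ × ℂ := fun p => (F₂ p.1 p.2, G₂ p.1 p.2) with hΦ₂
  have a₁ : AnalyticAt ℂ Φ₁ 0 := hF₁.prod hG₁
  have a₂ : AnalyticAt ℂ Φ₂ 0 := hF₂.prod hG₂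
  have z₁ : Φ₁ 0 = 0 := by simp [hΦ₁, hF₁0, hG₁0]
  have z₂ : Φ₂ 0 = 0 := by simp [hΦ₂, hF₂0, hG₂0]
  have hfd : fderiv ℂ Φ₂ 0 = (fderiv ℂ (fun p : ℂ × ℂ => F₂ p.1 p.2) 0).prod
      (fderiv ℂ (fun p : ℂ × ℂ => G₂ p.1 p.2) 0) :=
    (hF₂.differentiableAt.hasFDerivAt.prodMk hG₂.differentiableAt.hasFDerivAt).fderiv
  obtain ⟨K, hK, hK0, hKl, hKr⟩ := exists_local_inverse a₂ z₂
    (a := pd F₂ 1 0 0 0) (b := pd F₂ 0 1 0 0) (c := pd G₂ 1 0 0 0) (d := pd G₂ 0 1 0 0)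
    (by rw [hfd, pd_one_zero_eq_fderiv hF₂, pd_one_zero_eq_fderiv hG₂]; rfl)
    (by rw [hfd, pd_zero_one_eq_fderiv hF₂, pd_zero_one_eq_fderiv hG₂]; rfl) hdet
  set H : ℂ × ℂ → ℂ × ℂ := fun p => K (Φ₁ p) with hH
  have tΦ₁ : Tendsto Φ₁ (𝓝 0) (𝓝 0) := by simpa [z₁] using a₁.continuousAt.tendsto
  have tΦ₂ : Tendsto Φ₂ (𝓝 0) (𝓝 0) := by simpa [z₂] using a₂.continuousAt.tendsto
  have tK : Tendsto K (𝓝 0) (𝓝 0) := by simpa [hK0] using hK.continuousAt.tendsto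
  have tH : Tendsto H (𝓝 0) (𝓝 0) := tK.comp tΦ₁
  have aH : AnalyticAt ℂ H 0 := AnalyticAt.comp (by rwa [z₁]) a₁
  have hΦH : ∀ᶠ p in 𝓝 0, Φ₂ (H p) = Φ₁ p := tΦ₁.eventually hKr
  have hHO : (fun p => H p - p) =O[𝓝 0] fun p => ‖p‖ ^ 3 := by
    have h1 : (fun p => Φ₁ p - Φ₂ p) =O[𝓝 0] fun p => ‖p‖ ^ 3 :=
      (isBigO_sub_of_pd_eq hF₁ hF₂ fun i j hij => (hjet i j hij).1).prod_left
        (isBigO_sub_of_pd_eq hG₁ hG₂ fun i j hij => (hjet i j hij).2)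
    have h2 : (fun p => K (Φ₁ p) - K (Φ₂ p)) =O[𝓝 0] fun p => Φ₁ p - Φ₂ p :=
      hK.hasStrictFDerivAt.isBigO_sub.comp_tendsto (tΦ₁.prodMk_nhds tΦ₂)
    refine (h2.trans h1).congr' ?_ EventuallyEq.rfl
    filter_upwards [hKl] with p hp
    rw [hp]
  have hQ0 : Q 0 0 0 = 0 := hQ.2.1.self_of_nhds
  have tQ : Tendsto (fun q : ℂ × ℂ × ℂ => Q q.1 q.2.1 q.2.2) (𝓝 0) (𝓝 0) := by
    have := hQ.1.continuousAt.tendsto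
    simpa [hQ0] using this
  have t1 : Tendsto (fun q : ℂ × ℂ × ℂ => (q.1, Q q.1 q.2.1 q.2.2)) (𝓝 0) (𝓝 0) :=
    (continuous_fst.tendsto' (0 : ℂ × ℂ × ℂ) 0 rfl).prodMk_nhds tQ
  have t2 : Tendsto (fun q : ℂ × ℂ × ℂ => (cj q.2.1, cj q.2.2)) (𝓝 0) (𝓝 0) :=
    (tendsto_cj_zero.comp ((continuous_fst.comp continuous_snd).tendsto' (0 : ℂ × ℂ × ℂ) 0 rfl)).prodMk_nhds
      (tendsto_cj_zero.comp ((continuous_snd.comp continuous_snd).tendsto' (0 : ℂ × ℂ × ℂ) 0 rfl))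
  have fst0 : Tendsto (Prod.fst : ℂ × ℂ → ℂ) (𝓝 0) (𝓝 0) := continuous_fst.tendsto' 0 0 rfl
  have snd0 : Tendsto (Prod.snd : ℂ × ℂ → ℂ) (𝓝 0) (𝓝 0) := continuous_snd.tendsto' 0 0 rfl
  have cjp : ∀ {f : ℂ × ℂ × ℂ → ℂ × ℂ}, Tendsto f (𝓝 0) (𝓝 0) →
      Tendsto (fun q => (cj (f q).1, cj (f q).2)) (𝓝 0) (𝓝 0) := fun hf =>
    (tendsto_cj_zero.comp (fst0.comp hf)).prodMk_nhds (tendsto_cj_zero.comp (snd0.comp hf))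
  have t3 : Tendsto (fun q : ℂ × ℂ × ℂ => ((H (q.1, Q q.1 q.2.1 q.2.2)).1,
      cj (H (cj q.2.1, cj q.2.2)).1, cj (H (cj q.2.1, cj q.2.2)).2)) (𝓝 0) (𝓝 0) :=
    (fst0.comp (tH.comp t1)).prodMk_nhds (cjp (tH.comp t2))
  have t4 : Tendsto (fun q : ℂ × ℂ × ℂ => ((H (q.1, Q q.1 q.2.1 q.2.2)),
      Q (H (q.1, Q q.1 q.2.1 q.2.2)).1 (cj (H (cj q.2.1, cj q.2.2)).1)
        (cj (H (cj q.2.1, cj q.2.2)).2),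
      cj (Φ₁ (cj q.2.1, cj q.2.2)).1, cj (Φ₁ (cj q.2.1, cj q.2.2)).2)) (𝓝 0) (𝓝 0) :=
    (tH.comp t1).prodMk_nhds ((tQ.comp t3).prodMk_nhds (cjp (tΦ₁.comp t2)))
  have hmap : ∀ᶠ q : ℂ × ℂ × ℂ in 𝓝 0, (H (q.1, Q q.1 q.2.1 q.2.2)).2 =
      Q (H (q.1, Q q.1 q.2.1 q.2.2)).1 (cj (H (cj q.2.1, cj q.2.2)).1)
        (cj (H (cj q.2.1, cj q.2.2)).2) := by
    filter_upwards [hm₁, t3.eventually hm₂, t1.eventually hΦH, t2.eventually hΦH,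
      t4.eventually (eventually_snd_eq_of_defining_eq hQ' hF₂ hG₂ hF₂0 hGw)]
      with q e1 e2 e3 e4 e5
    simp only [cj_cj, hΦ₁, hΦ₂, Prod.mk.injEq] at e1 e2 e3 e4 e5
    refine e5 ?_ ?_
    · rw [e2, e4.1, e4.2]
    · rw [e3.1, e3.2, e1]
  have hid := eq_id_of_isBigO_three (Q := fun q => Q q.1 q.2.1 q.2.2) (F := fun p => (H p).1)
    (G := fun p => (H p).2) hQ.1 hQ.2.1 hQ.2.2.1 hFT (analyticAt_fst.comp aH)
    (analyticAt_snd.comp aH) (Asymptotics.isBigO_fst_prod.trans hHO)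
    (Asymptotics.isBigO_snd_prod.trans hHO) hmap
  filter_upwards [hid, hΦH] with p e1 e2
  rw [show H p = p from Prod.ext e1.1 e1.2] at e2
  exact ⟨(congrArg Prod.fst e2).symm, (congrArg Prod.snd e2).symm⟩
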